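/- arXiv:math/9904044 — 3 statements merged into one kernel-verified Lean document; each statement's English description precedes it below -/
import Mathlib

section
/- The von Neumann algebra of bounded operators on L²(ℍ, dx) commuting simultaneously with both the left dilation action L₁ and the right dilation action R₁ of the multiplicative quaternion group ℍ^× is abelian. -/
open Quaternion MeasureTheory
open scoped Real Quaternion ENNReal

noncomputable section

instance : MeasurableSpace ℍ[ℝ] := borel _
instance : BorelSpace ℍ[ℝ] := ⟨rfl⟩

/-- The coordinate Lebesgue measure `dx₀dx₁dx₂dx₃` on `ℍ ≅ ℝ⁴`. -/
def qLeb : Measure ℍ[ℝ] :=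
  Measure.map (fun v : Fin 4 → ℝ => (Quaternion.equivTuple ℝ).symm v) volume

/-- The self-dual Haar measure `dx = 4 dx₀dx₁dx₂dx₃` on `ℍ`. -/
def muH : Measure ℍ[ℝ] := (4 : ℝ≥0∞) • qLeb

section Abstract

open scoped ComplexConjugate InnerProductSpace

namespace L2Complex

variable {α : Type*} [MeasurableSpace α] {ν : Measure α}

lemma integrable_norm_sq (s : Lp ℂ 2 ν) : Integrable (fun x => ‖s x‖ ^ 2) ν :=
  (memLp_two_iff_integrable_sq_norm (Lp.aestronglyMeasurable s)).1 (Lp.memLp s)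

lemma inner_compMeasurePreserving (s p : Lp ℂ 2 ν) {f : α → α} (hf : MeasurePreserving f ν ν) :
    ⟪s, Lp.compMeasurePreserving f hf p⟫_ℂ = ∫ x, conj (s x) * p (f x) ∂ν := by
  rw [L2.inner_def]
  refine integral_congr_ae ?_
  filter_upwards [Lp.coeFn_compMeasurePreserving p hf] with x hx
  rw [hx, RCLike.inner_apply, mul_comm, Function.comp]

lemma dense_integrable : Dense {u : Lp ℂ 2 ν | Integrable u ν} := by
  refine (Lp.simpleFunc.dense (E := ℂ) (μ := ν) (p := 2) (by simp)).mono fun u hu => ?_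
  have h1 := Lp.simpleFunc.memLp (⟨u, hu⟩ : Lp.simpleFunc ℂ 2 ν)
  have h2 := (SimpleFunc.memLp_iff_integrable (by simp) (by simp)).1 h1
  exact h2.congr (Lp.simpleFunc.toSimpleFunc_eq_toFun _)

lemma inner_star_left (u v : Lp ℂ 2 ν) : ⟪star u, v⟫_ℂ = ∫ x, u x * v x ∂ν := by
  rw [L2.inner_def]
  refine integral_congr_ae ?_
  filter_upwards [Lp.coeFn_star u] with x hx
  rw [hx, RCLike.inner_apply, mul_comm]
  simp

lemma inner_star_comm (u v : Lp ℂ 2 ν) : ⟪star u, v⟫_ℂ = ⟪star v, u⟫_ℂ := by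
  simp only [inner_star_left, mul_comm]

end L2Complex

open L2Complex

variable {G : Type*} [GroupWithZero G] [MeasurableSpace G]

/-- A measure on a group with zero which comes from a two-sided and inversion invariant measure
on the group of nonzero elements. -/
structure IsUnimodularOnUnits (ν : Measure G) : Prop where
  ae_ne_zero : ∀ᵐ x ∂ν, x ≠ 0
  mul_left : ∀ g : G, g ≠ 0 → MeasurePreserving (fun x => g * x) ν ν
  mul_right : ∀ g : G, g ≠ 0 → MeasurePreserving (fun x => x * g) ν ν
  inv : MeasurePreserving (fun x : G => x⁻¹) ν ν

/-- The kernel whose integral pairs `s` with the convolution of `p` and `h`. -/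
def convKernel (s p h : G → ℂ) (q : G × G) : ℂ :=
  conj (s q.2) * (p q.1 * h (q.1⁻¹ * q.2))

namespace IsUnimodularOnUnits

variable {ν : Measure G}

lemma inv_mul_left (hν : IsUnimodularOnUnits ν) (x : G) (hx : x ≠ 0) :
    MeasurePreserving (fun y => y⁻¹ * x) ν ν :=
  (hν.mul_right x hx).comp hν.inv

lemma mul_inv_right (hν : IsUnimodularOnUnits ν) (x : G) (hx : x ≠ 0) :
    MeasurePreserving (fun y => x * y⁻¹) ν ν :=
  (hν.mul_left x hx).comp hν.inv

/-- Operators commuting with left and right translations by nonzero elements. -/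
structure CommutesWithTranslations (hν : IsUnimodularOnUnits ν)
    (A : Lp ℂ 2 ν →L[ℂ] Lp ℂ 2 ν) : Prop where
  mul_left : ∀ (g : G) (hg : g ≠ 0) (u : Lp ℂ 2 ν),
    A (Lp.compMeasurePreserving _ (hν.mul_left g hg) u) =
      Lp.compMeasurePreserving _ (hν.mul_left g hg) (A u)
  mul_right : ∀ (g : G) (hg : g ≠ 0) (u : Lp ℂ 2 ν),
    A (Lp.compMeasurePreserving _ (hν.mul_right g hg) u) =
      Lp.compMeasurePreserving _ (hν.mul_right g hg) (A u)

lemma CommutesWithTranslations.comp {hν : IsUnimodularOnUnits ν} {A B : Lp ℂ 2 ν →L[ℂ] Lp ℂ 2 ν}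
    (hA : CommutesWithTranslations hν A) (hB : CommutesWithTranslations hν B) :
    CommutesWithTranslations hν (A.comp B) where
  mul_left g hg u := by
    rw [ContinuousLinearMap.comp_apply, hB.mul_left g hg, hA.mul_left g hg]; rfl
  mul_right g hg u := by
    rw [ContinuousLinearMap.comp_apply, hB.mul_right g hg, hA.mul_right g hg]; rfl

lemma inner_star_inv_mul (hν : IsUnimodularOnUnits ν) (u v : Lp ℂ 2 ν) (x : G) (hx : x ≠ 0) :
    ⟪star u, Lp.compMeasurePreserving _ (hν.inv_mul_left x hx) v⟫_ℂ =
      ∫ y, u y * v (y⁻¹ * x) ∂ν := by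
  rw [inner_star_left]
  refine integral_congr_ae ?_
  filter_upwards [Lp.coeFn_compMeasurePreserving v (hν.inv_mul_left x hx)] with y hy
  rw [hy, Function.comp]

variable [MeasurableMul₂ G] [MeasurableInv G]

lemma measurable_convKernel (s p h : Lp ℂ 2 ν) : Measurable (convKernel s p h) := by
  have hs := (Lp.stronglyMeasurable s).measurable
  have hp := (Lp.stronglyMeasurable p).measurable
  have hh := (Lp.stronglyMeasurable h).measurable
  unfold convKernel
  refine Measurable.mul ?_ (by fun_prop)
  exact Complex.continuous_conj.measurable.comp (by fun_prop)

variable [SigmaFinite ν]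

lemma shear_fst (hν : IsUnimodularOnUnits ν) :
    MeasurePreserving (fun q : G × G => (q.1, q.1⁻¹ * q.2)) (ν.prod ν) (ν.prod ν) := by
  refine MeasurePreserving.skew_product (MeasurePreserving.id ν) (g := fun a b => a⁻¹ * b)
    (by unfold Function.uncurry; fun_prop) ?_
  filter_upwards [hν.ae_ne_zero] with a ha using (hν.mul_left a⁻¹ (inv_ne_zero ha)).map_eq

lemma shear_snd (hν : IsUnimodularOnUnits ν) :
    MeasurePreserving (fun q : G × G => (q.2, q.1⁻¹ * q.2)) (ν.prod ν) (ν.prod ν) := by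
  have h : MeasurePreserving (fun q : G × G => (q.1, q.2⁻¹ * q.1)) (ν.prod ν) (ν.prod ν) := by
    refine MeasurePreserving.skew_product (MeasurePreserving.id ν) (g := fun a b => b⁻¹ * a)
      (by unfold Function.uncurry; fun_prop) ?_
    filter_upwards [hν.ae_ne_zero] with a ha using (hν.inv_mul_left a ha).map_eq
  exact h.comp Measure.measurePreserving_swap

lemma shear_mul_inv (hν : IsUnimodularOnUnits ν) :
    MeasurePreserving (fun q : G × G => (q.2 * q.1⁻¹, q.2)) (ν.prod ν) (ν.prod ν) := by
  have h : MeasurePreserving (fun q : G × G => (q.1, q.1 * q.2⁻¹)) (ν.prod ν) (ν.prod ν) := by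
    refine MeasurePreserving.skew_product (MeasurePreserving.id ν) (g := fun a b => a * b⁻¹)
      (by unfold Function.uncurry; fun_prop) ?_
    filter_upwards [hν.ae_ne_zero] with a ha using (hν.mul_inv_right a ha).map_eq
  exact Measure.measurePreserving_swap.comp (h.comp Measure.measurePreserving_swap)

lemma integrable_convKernel_of_right (hν : IsUnimodularOnUnits ν)
    (s p h : Lp ℂ 2 ν) (hh : Integrable h ν) :
    Integrable (convKernel s p h) (ν.prod ν) := by
  have h1 := hν.shear_fst.integrable_comp_of_integrable
    ((integrable_norm_sq p).mul_prod hh.norm)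
  have h2 := hν.shear_snd.integrable_comp_of_integrable
    ((integrable_norm_sq s).mul_prod hh.norm)
  refine (h1.add h2).mono' (measurable_convKernel s p h).aestronglyMeasurable
    (.of_forall fun q => ?_)
  simp only [convKernel, norm_mul, RCLike.norm_conj, Function.comp, Pi.add_apply]
  have h3 : 0 ≤ ((‖s q.2‖ - ‖p q.1‖) ^ 2 + ‖s q.2‖ ^ 2 + ‖p q.1‖ ^ 2) * ‖h (q.1⁻¹ * q.2)‖ := by
    positivity
  linarith

lemma integrable_convKernel_of_left (hν : IsUnimodularOnUnits ν)
    (s p h : Lp ℂ 2 ν) (hp : Integrable p ν) :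
    Integrable (convKernel s p h) (ν.prod ν) := by
  have h1 := hν.shear_fst.integrable_comp_of_integrable
    (hp.norm.mul_prod (integrable_norm_sq h))
  have h2 := hp.norm.mul_prod (integrable_norm_sq s)
  refine (h1.add h2).mono' (measurable_convKernel s p h).aestronglyMeasurable
    (.of_forall fun q => ?_)
  simp only [convKernel, norm_mul, RCLike.norm_conj, Function.comp, Pi.add_apply]
  have h3 : 0 ≤ ‖p q.1‖ * ((‖s q.2‖ - ‖h (q.1⁻¹ * q.2)‖) ^ 2 + ‖s q.2‖ ^ 2 +
      ‖h (q.1⁻¹ * q.2)‖ ^ 2) := by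
    positivity
  linarith

lemma integral_convKernel_of_right (hν : IsUnimodularOnUnits ν)
    (s p h : Lp ℂ 2 ν) (hh : Integrable h ν) :
    ∫ q, convKernel s p h q ∂ν.prod ν =
      ∫ z, (∫ x, conj (s x) * p (x * z⁻¹) ∂ν) * h z ∂ν := by
  have hint := hν.integrable_convKernel_of_right s p h hh
  have hmp := hν.shear_mul_inv
  rw [← hmp.map_eq, integral_map hmp.aemeasurable
    (by rw [hmp.map_eq]; exact hint.aestronglyMeasurable)]
  refine (integral_prod _ (hmp.integrable_comp_of_integrable hint)).trans ?_
  refine integral_congr_ae ?_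
  filter_upwards [hν.ae_ne_zero] with z hz
  rw [← integral_mul_const]
  refine integral_congr_ae ?_
  filter_upwards [hν.ae_ne_zero] with x hx
  have : (x * z⁻¹)⁻¹ * x = z := by
    rw [mul_inv_rev, inv_inv, mul_assoc, inv_mul_cancel₀ hx, mul_one]
  simp only [Function.comp, convKernel, this, mul_assoc]

lemma integral_convKernel_of_left (hν : IsUnimodularOnUnits ν)
    (s p h : Lp ℂ 2 ν) (hp : Integrable p ν) :
    ∫ q, convKernel s p h q ∂ν.prod ν =
      ∫ y, p y * (∫ x, conj (s x) * h (y⁻¹ * x) ∂ν) ∂ν := by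
  rw [integral_prod _ (hν.integrable_convKernel_of_left s p h hp)]
  refine integral_congr_ae (.of_forall fun y => ?_)
  simp only [convKernel]
  rw [← integral_const_mul]
  exact integral_congr_ae (.of_forall fun x => by ring)

lemma integral_convKernel_apply (hν : IsUnimodularOnUnits ν) {A : Lp ℂ 2 ν →L[ℂ] Lp ℂ 2 ν}
    (hA : CommutesWithTranslations hν A) (s p h : Lp ℂ 2 ν) (hp : Integrable p ν)
    (hh : Integrable h ν) :
    ∫ q, convKernel s (A p) h q ∂ν.prod ν = ∫ q, convKernel s p (A h) q ∂ν.prod ν := by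
  trans ∫ q, convKernel (A.adjoint s) p h q ∂ν.prod ν
  · rw [hν.integral_convKernel_of_right _ _ _ hh, hν.integral_convKernel_of_right _ _ _ hh]
    refine integral_congr_ae ?_
    filter_upwards [hν.ae_ne_zero] with z hz
    have hmp := hν.mul_right z⁻¹ (inv_ne_zero hz)
    rw [← inner_compMeasurePreserving _ _ hmp, ← inner_compMeasurePreserving _ _ hmp,
      ContinuousLinearMap.adjoint_inner_left, hA.mul_right _ (inv_ne_zero hz)]
  · rw [hν.integral_convKernel_of_left _ _ _ hp, hν.integral_convKernel_of_left _ _ _ hp]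
    refine integral_congr_ae ?_
    filter_upwards [hν.ae_ne_zero] with z hz
    have hmp := hν.mul_left z⁻¹ (inv_ne_zero hz)
    rw [← inner_compMeasurePreserving _ _ hmp, ← inner_compMeasurePreserving _ _ hmp,
      ContinuousLinearMap.adjoint_inner_left, hA.mul_left _ (inv_ne_zero hz)]

lemma setIntegral_convolution (hν : IsUnimodularOnUnits ν)
    {p h : Lp ℂ 2 ν} (hph : Integrable p ν ∨ Integrable h ν)
    {E : Set G} (hE : MeasurableSet E) (hEν : ν E < ∞) :
    IntegrableOn (fun x => ∫ y, p y * h (y⁻¹ * x) ∂ν) E ν ∧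
    ∫ x in E, ∫ y, p y * h (y⁻¹ * x) ∂ν ∂ν =
      ∫ q, convKernel (indicatorConstLp 2 hE hEν.ne (1 : ℂ) : Lp ℂ 2 ν) p h q ∂ν.prod ν := by
  have hint : Integrable (convKernel (indicatorConstLp 2 hE hEν.ne (1 : ℂ) : Lp ℂ 2 ν) p h)
      (ν.prod ν) := by
    rcases hph with hp | hh
    · exact hν.integrable_convKernel_of_left _ _ _ hp
    · exact hν.integrable_convKernel_of_right _ _ _ hh
  have hae : (fun x => ∫ y, convKernel (indicatorConstLp 2 hE hEν.ne (1 : ℂ) : Lp ℂ 2 ν) p h (y, x)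
      ∂ν) =ᵐ[ν] E.indicator (fun x => ∫ y, p y * h (y⁻¹ * x) ∂ν) := by
    filter_upwards [indicatorConstLp_coeFn (p := 2) (hs := hE) (hμs := hEν.ne) (c := (1 : ℂ))]
      with x hx
    simp only [convKernel, hx]
    by_cases hxE : x ∈ E <;> simp [hxE]
  constructor
  · rw [← integrable_indicator_iff hE]
    exact hint.integral_prod_right.congr hae
  · rw [← integral_indicator hE, integral_prod_symm _ hint]
    exact (integral_congr_ae hae).symm

lemma convolution_apply_ae_eq (hν : IsUnimodularOnUnits ν) {A : Lp ℂ 2 ν →L[ℂ] Lp ℂ 2 ν}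
    (hA : CommutesWithTranslations hν A) (p h : Lp ℂ 2 ν) (hp : Integrable p ν)
    (hh : Integrable h ν) :
    (fun x => ∫ y, A p y * h (y⁻¹ * x) ∂ν) =ᵐ[ν] fun x => ∫ y, p y * A h (y⁻¹ * x) ∂ν := by
  refine ae_eq_of_forall_setIntegral_eq_of_sigmaFinite
    (fun E hE hEν => (hν.setIntegral_convolution (.inr hh) hE hEν).1)
    (fun E hE hEν => (hν.setIntegral_convolution (.inl hp) hE hEν).1) fun E hE hEν => ?_
  rw [(hν.setIntegral_convolution (.inr hh) hE hEν).2,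
    (hν.setIntegral_convolution (.inl hp) hE hEν).2, hν.integral_convKernel_apply hA _ _ _ hp hh]

lemma ae_forall_inner_star_apply (hν : IsUnimodularOnUnits ν)
    [IsSeparable ν] {A : Lp ℂ 2 ν →L[ℂ] Lp ℂ 2 ν}
    (hA : CommutesWithTranslations hν A) :
    ∀ᵐ x ∂ν, ∀ (hx : x ≠ 0) (u v : Lp ℂ 2 ν),
      ⟪star (A u), Lp.compMeasurePreserving _ (hν.inv_mul_left x hx) v⟫_ℂ =
        ⟪star u, Lp.compMeasurePreserving _ (hν.inv_mul_left x hx) (A v)⟫_ℂ := by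
  have : Fact ((2 : ℝ≥0∞) ≠ ∞) := ⟨by simp⟩
  obtain ⟨D, hDs, hDc, hD⟩ := (dense_integrable (ν := ν)).exists_countable_dense_subset
  have key : ∀ᵐ x ∂ν, ∀ u ∈ D, ∀ v ∈ D,
      ∫ y, A u y * v (y⁻¹ * x) ∂ν = ∫ y, u y * A v (y⁻¹ * x) ∂ν :=
    (ae_ball_iff hDc).2 fun u hu => (ae_ball_iff hDc).2 fun v hv =>
      hν.convolution_apply_ae_eq hA u v (hDs hu) (hDs hv)
  filter_upwards [key] with x hxD hx
  have hK : Continuous (Lp.compMeasurePreserving (E := ℂ) (p := 2) _ (hν.inv_mul_left x hx)) :=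
    (Lp.isometry_compMeasurePreserving (hν.inv_mul_left x hx)).continuous
  have step : ∀ u ∈ D, ∀ v,
      ⟪star (A u), Lp.compMeasurePreserving _ (hν.inv_mul_left x hx) v⟫_ℂ =
        ⟪star u, Lp.compMeasurePreserving _ (hν.inv_mul_left x hx) (A v)⟫_ℂ := by
    intro u hu
    refine congrFun (Continuous.ext_on hD (continuous_const.inner hK)
      (continuous_const.inner (hK.comp A.continuous)) fun v hv => ?_)
    exact (hν.inner_star_inv_mul _ _ x hx).trans
      ((hxD u hu v hv).trans (hν.inner_star_inv_mul _ _ x hx).symm)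
  intro u v
  rw [inner_star_comm, inner_star_comm u]
  refine congrFun (Continuous.ext_on hD (continuous_const.inner A.continuous)
      (continuous_const.inner continuous_id) fun u hu => ?_) u
  simp only [id]
  rw [inner_star_comm, step u hu v, inner_star_comm]

theorem comp_comm (hν : IsUnimodularOnUnits ν)
    [IsSeparable ν] [NeZero ν] {A B : Lp ℂ 2 ν →L[ℂ] Lp ℂ 2 ν}
    (hA : CommutesWithTranslations hν A) (hB : CommutesWithTranslations hν B) :
    A.comp B = B.comp A := by
  obtain ⟨x, hx, hxA, hxB, hxAB⟩ := (hν.ae_ne_zero.and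
    ((hν.ae_forall_inner_star_apply hA).and ((hν.ae_forall_inner_star_apply hB).and
      (hν.ae_forall_inner_star_apply (hA.comp hB))))).exists
  ext1 v
  refine (Lp.isometry_compMeasurePreserving (hν.inv_mul_left x hx)).injective ?_
  refine ext_inner_left ℂ fun u => ?_
  rw [← star_star u, ← hxAB hx, ContinuousLinearMap.comp_apply, ContinuousLinearMap.comp_apply,
    ← hxB hx, ← hxA hx]

end IsUnimodularOnUnits

end Abstract

section Inversion

variable {G : Type*} [GroupWithZero G] [MeasurableSpace G] [MeasurableMul₂ G] [MeasurableInv G]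
  {ν : Measure G} [SigmaFinite ν]

lemma lintegral_inv_mul_lintegral (h0 : ∀ᵐ x ∂ν, x ≠ 0)
    (hl : ∀ g : G, g ≠ 0 → MeasurePreserving (fun x => g * x) ν ν)
    (hr : ∀ g : G, g ≠ 0 → MeasurePreserving (fun x => x * g) ν ν)
    {f g : G → ℝ≥0∞} (hf : Measurable f) (hg : Measurable g) :
    (∫⁻ x, f x⁻¹ ∂ν) * ∫⁻ x, g x ∂ν = (∫⁻ x, f x⁻¹ ∂ν) * ∫⁻ x, g x⁻¹ ∂ν := by
  calc (∫⁻ x, f x⁻¹ ∂ν) * ∫⁻ x, g x ∂ν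
      = ∫⁻ y, ∫⁻ x, f x⁻¹ * g y ∂ν ∂ν := by
        rw [← lintegral_const_mul _ hg]
        exact lintegral_congr fun y => (lintegral_mul_const _ (by fun_prop)).symm
    _ = ∫⁻ y, ∫⁻ x, f (y * x)⁻¹ * g y ∂ν ∂ν := by
        refine lintegral_congr_ae ?_
        filter_upwards [h0] with y hy
        exact ((hl y hy).lintegral_comp (f := fun x => f x⁻¹ * g y) (by fun_prop)).symm
    _ = ∫⁻ x, ∫⁻ y, f (y * x)⁻¹ * g y ∂ν ∂ν :=
        lintegral_lintegral_swap (by unfold Function.uncurry; fun_prop)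
    _ = ∫⁻ x, ∫⁻ y, f y⁻¹ * g (y * x⁻¹) ∂ν ∂ν := by
        refine lintegral_congr_ae ?_
        filter_upwards [h0] with x hx
        rw [← (hr x⁻¹ (inv_ne_zero hx)).lintegral_comp (by fun_prop)]
        simp only [inv_mul_cancel_right₀ hx]
    _ = ∫⁻ y, ∫⁻ x, f y⁻¹ * g (y * x⁻¹) ∂ν ∂ν :=
        lintegral_lintegral_swap (by unfold Function.uncurry; fun_prop)
    _ = ∫⁻ y, ∫⁻ x, f y⁻¹ * g x⁻¹ ∂ν ∂ν := by
        refine lintegral_congr_ae ?_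
        filter_upwards [h0] with y hy
        rw [← (hr y hy).lintegral_comp (by fun_prop)]
        simp only [mul_inv_rev, mul_inv_cancel_left₀ hy]
    _ = (∫⁻ x, f x⁻¹ ∂ν) * ∫⁻ x, g x⁻¹ ∂ν := by
        rw [← lintegral_mul_const _ (by fun_prop)]
        exact lintegral_congr fun y => lintegral_const_mul _ (by fun_prop)

lemma IsUnimodularOnUnits.of_mul_invariant (h0 : ∀ᵐ x ∂ν, x ≠ 0)
    (hl : ∀ g : G, g ≠ 0 → MeasurePreserving (fun x => g * x) ν ν)
    (hr : ∀ g : G, g ≠ 0 → MeasurePreserving (fun x => x * g) ν ν)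
    {E : Set G} (hE : MeasurableSet E) (hE0 : ν E ≠ 0) (hEt : ν E ≠ ∞) :
    IsUnimodularOnUnits ν := by
  refine ⟨h0, hl, hr, measurable_inv, ?_⟩
  ext S hS
  have key := lintegral_inv_mul_lintegral h0 hl hr (f := fun x => E.indicator 1 x⁻¹)
    (g := S.indicator 1) ((measurable_one.indicator hE).comp measurable_inv)
    (measurable_one.indicator hS)
  have hS' : ∫⁻ x, S.indicator (1 : G → ℝ≥0∞) x⁻¹ ∂ν = ν ((fun x => x⁻¹) ⁻¹' S) := by
    rw [← lintegral_indicator_one (measurable_inv hS)]; rfl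
  simp only [inv_inv] at key
  rw [lintegral_indicator_one hE, lintegral_indicator_one hS, hS'] at key
  rw [Measure.map_apply measurable_inv hS]
  exact ((ENNReal.mul_right_inj hE0 hEt).1 key).symm

end Inversion

section QuaternionHaar

instance : muH.IsAddHaarMeasure := by
  let e : (Fin 4 → ℝ) ≃ₗ[ℝ] ℍ[ℝ] := (QuaternionAlgebra.linearEquivTuple (-1 : ℝ) 0 (-1)).symm
  have h : qLeb.IsAddHaarMeasure := e.toContinuousLinearEquiv.isAddHaarMeasure_map volume
  exact Measure.IsAddHaarMeasure.smul qLeb (by norm_num) (by norm_num)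

lemma map_muH_of_norm_eq_mul (f : ℍ[ℝ] →ₗ[ℝ] ℍ[ℝ]) {c : ℝ} (hc : 0 < c)
    (hf : ∀ x, ‖f x‖ = c * ‖x‖) :
    ENNReal.ofReal (c ^ 4) • Measure.map f muH = muH := by
  have hinj : Function.Injective f := by
    refine (injective_iff_map_eq_zero f).2 fun x hx => ?_
    have := hf x
    rw [hx, norm_zero, eq_comm, mul_eq_zero] at this
    simpa [hc.ne'] using this
  have hdet : LinearMap.det f ≠ 0 := by
    have := (LinearEquiv.ofInjectiveEndo f hinj).isUnit_det'
    exact this.ne_zero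
  have hmap := Measure.map_linearMap_addHaar_eq_smul_addHaar muH hdet
  have hcont : Continuous f := f.continuous_of_finiteDimensional
  have hball : f ⁻¹' Metric.ball 0 c = Metric.ball 0 1 := by
    ext x
    simp [hf, hc]
  have h1 : muH (Metric.ball 0 1) =
      ENNReal.ofReal |(LinearMap.det f)⁻¹| * (ENNReal.ofReal (c ^ 4) * muH (Metric.ball 0 1)) := by
    have := congrArg (fun m : Measure ℍ[ℝ] => m (Metric.ball 0 c)) hmap
    simp only [Measure.map_apply hcont.measurable measurableSet_ball, hball, Measure.smul_apply,
      smul_eq_mul] at this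
    rwa [Measure.addHaar_ball_of_pos muH (0 : ℍ[ℝ]) hc, Quaternion.finrank_eq_four] at this
  have hb0 : muH (Metric.ball 0 1) ≠ 0 := (Metric.measure_ball_pos muH 0 one_pos).ne'
  have hbt : muH (Metric.ball 0 1) ≠ ∞ := measure_ball_lt_top.ne
  rw [hmap, smul_smul]
  rw [← mul_assoc] at h1
  have h2 : (1 : ℝ≥0∞) * muH (Metric.ball 0 1) = _ := (one_mul _).trans h1
  rw [mul_comm, ← (ENNReal.mul_left_inj hb0 hbt).1 h2, one_smul]

/-- The multiplicative Haar measure `dx / |x|` on `ℍ`. -/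
def mulHaarH : Measure ℍ[ℝ] :=
  muH.withDensity fun x => ENNReal.ofReal (‖x‖ ^ 4)⁻¹

lemma measurable_mulHaarH_density : Measurable fun x : ℍ[ℝ] => ENNReal.ofReal (‖x‖ ^ 4)⁻¹ := by
  fun_prop

instance : SigmaFinite mulHaarH :=
  SigmaFinite.withDensity_of_ne_top (.of_forall fun _ => ENNReal.ofReal_ne_top)

lemma mulHaarH_absolutelyContinuous : mulHaarH ≪ muH :=
  withDensity_absolutelyContinuous _ _

lemma ae_muH_ne_zero : ∀ᵐ x ∂muH, x ≠ 0 := by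
  simp [ae_iff]

lemma measurePreserving_mulHaarH_of_norm_eq_mul (f : ℍ[ℝ] →ₗ[ℝ] ℍ[ℝ]) {c : ℝ} (hc : 0 < c)
    (hf : ∀ x, ‖f x‖ = c * ‖x‖) : MeasurePreserving f mulHaarH mulHaarH := by
  have hfm : Measurable f := f.continuous_of_finiteDimensional.measurable
  refine ⟨hfm, ?_⟩
  ext S hS
  have hwS : Measurable (S.indicator fun x : ℍ[ℝ] => ENNReal.ofReal (‖x‖ ^ 4)⁻¹) :=
    measurable_mulHaarH_density.indicator hS
  rw [Measure.map_apply hfm hS, mulHaarH, withDensity_apply _ (hfm hS), withDensity_apply _ hS,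
    ← lintegral_indicator (hfm hS), ← lintegral_indicator hS]
  conv_rhs => rw [← map_muH_of_norm_eq_mul f hc hf]
  rw [lintegral_smul_measure, lintegral_map hwS hfm, smul_eq_mul]
  refine Eq.trans (lintegral_congr fun x => ?_) (lintegral_const_mul _ (hwS.comp hfm))
  by_cases hx : f x ∈ S
  · rw [Set.indicator_of_mem (show x ∈ f ⁻¹' S from hx), Set.indicator_of_mem hx, hf,
      ← ENNReal.ofReal_mul (by positivity), mul_pow, mul_inv, mul_inv_cancel_left₀ (by positivity)]
  · rw [Set.indicator_of_notMem (show x ∉ f ⁻¹' S from hx), Set.indicator_of_notMem hx, mul_zero]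

lemma measurableSet_annulus : MeasurableSet {x : ℍ[ℝ] | 1 < ‖x‖ ∧ ‖x‖ < 2} :=
  (measurableSet_lt measurable_const measurable_norm).inter
    (measurableSet_lt measurable_norm measurable_const)

lemma mulHaarH_annulus_ne_top : mulHaarH {x : ℍ[ℝ] | 1 < ‖x‖ ∧ ‖x‖ < 2} ≠ ∞ := by
  rw [mulHaarH, withDensity_apply _ measurableSet_annulus]
  refine ne_top_of_le_ne_top (measure_ball_lt_top (μ := muH) (x := 0) (r := 2)).ne ?_
  calc _ ≤ ∫⁻ _ in {x : ℍ[ℝ] | 1 < ‖x‖ ∧ ‖x‖ < 2}, 1 ∂muH := by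
        refine setLIntegral_mono' measurableSet_annulus fun x hx => ?_
        rw [← ENNReal.ofReal_one]
        exact ENNReal.ofReal_le_ofReal (inv_le_one_of_one_le₀ (one_le_pow₀ hx.1.le))
    _ ≤ muH (Metric.ball 0 2) := by
        rw [setLIntegral_one]
        exact measure_mono fun x hx => by simpa using hx.2

lemma mulHaarH_annulus_ne_zero : mulHaarH {x : ℍ[ℝ] | 1 < ‖x‖ ∧ ‖x‖ < 2} ≠ 0 := by
  have hopen : IsOpen {x : ℍ[ℝ] | 1 < ‖x‖ ∧ ‖x‖ < 2} :=
    (isOpen_lt continuous_const continuous_norm).inter (isOpen_lt continuous_norm continuous_const)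
  have hpos : muH {x : ℍ[ℝ] | 1 < ‖x‖ ∧ ‖x‖ < 2} ≠ 0 :=
    (hopen.measure_pos muH ⟨((3 / 2 : ℝ) : ℍ[ℝ]), by
      rw [Set.mem_ofPred_eq, Quaternion.norm_coe]; norm_num [abs_of_pos]⟩).ne'
  intro h
  rw [mulHaarH, withDensity_apply_eq_zero measurable_mulHaarH_density] at h
  refine hpos (measure_mono_null (fun x hx => Set.mem_inter ?_ hx) h)
  have : 0 < ‖x‖ := one_pos.trans hx.1
  simpa using pow_pos this 4

instance : NeZero mulHaarH :=
  ⟨fun h => mulHaarH_annulus_ne_zero (by simp [h])⟩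

theorem isUnimodularOnUnits_mulHaarH : IsUnimodularOnUnits mulHaarH :=
  .of_mul_invariant (mulHaarH_absolutelyContinuous.ae_le ae_muH_ne_zero)
    (fun g hg => measurePreserving_mulHaarH_of_norm_eq_mul (LinearMap.mulLeft ℝ g)
      (norm_pos_iff.2 hg) fun x => norm_mul g x)
    (fun g hg => measurePreserving_mulHaarH_of_norm_eq_mul (LinearMap.mulRight ℝ g)
      (norm_pos_iff.2 hg) fun x => (norm_mul x g).trans (mul_comm _ _))
    measurableSet_annulus mulHaarH_annulus_ne_zero mulHaarH_annulus_ne_top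

end QuaternionHaar

section Transfer

lemma eLpNorm_normSq_mul (f : ℍ[ℝ] → ℂ) :
    eLpNorm (fun x => ((normSq x : ℝ) : ℂ) * f x) 2 mulHaarH = eLpNorm f 2 muH := by
  rw [eLpNorm_eq_lintegral_rpow_enorm_toReal (by simp) (by simp),
    eLpNorm_eq_lintegral_rpow_enorm_toReal (by simp) (by simp), mulHaarH,
    lintegral_withDensity_eq_lintegral_mul_non_measurable _ measurable_mulHaarH_density
      (.of_forall fun _ => ENNReal.ofReal_lt_top)]
  congr 1
  refine lintegral_congr_ae ?_
  filter_upwards [ae_muH_ne_zero] with x hx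
  have hx' : 0 < ‖x‖ := norm_pos_iff.2 hx
  have h : ‖((normSq x : ℝ) : ℂ)‖ₑ = ENNReal.ofReal (‖x‖ ^ 2) := by
    rw [← ofReal_norm, Complex.norm_real, normSq_eq_norm_mul_self, ← sq, norm_pow,
      norm_norm]
  simp only [Pi.mul_apply, enorm_mul, h, ENNReal.toReal_ofNat, ENNReal.rpow_ofNat, mul_pow]
  rw [← mul_assoc, ← ENNReal.ofReal_pow (by positivity), ← ENNReal.ofReal_mul (by positivity),
    ← pow_mul, inv_mul_cancel₀ (by positivity), ENNReal.ofReal_one, one_mul]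

lemma measurable_normSq_mul {f : ℍ[ℝ] → ℂ} (hf : Measurable f) :
    Measurable fun x => ((normSq x : ℝ) : ℂ) * f x :=
  (Complex.measurable_ofReal.comp Quaternion.continuous_normSq.measurable).mul hf

lemma memLp_normSq_mul (u : Lp ℂ 2 muH) :
    MemLp (fun x => ((normSq x : ℝ) : ℂ) * u x) 2 mulHaarH := by
  have hu := (Lp.stronglyMeasurable u).measurable
  exact ⟨(measurable_normSq_mul hu).aestronglyMeasurable,
    (eLpNorm_normSq_mul u).trans_lt (Lp.memLp u).2⟩

/-- Multiplication by `|x|^{1/2}`, as an isometry from `L²(ℍ, dx)` to `L²(ℍ, dx / |x|)`. -/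
def normSqMulLI : Lp ℂ 2 muH →ₗᵢ[ℂ] Lp ℂ 2 mulHaarH where
  toFun u := (memLp_normSq_mul u).toLp _
  map_add' u v := by
    ext1
    filter_upwards [(memLp_normSq_mul (u + v)).coeFn_toLp, (memLp_normSq_mul u).coeFn_toLp,
      (memLp_normSq_mul v).coeFn_toLp, Lp.coeFn_add ((memLp_normSq_mul u).toLp _)
        ((memLp_normSq_mul v).toLp _), mulHaarH_absolutelyContinuous.ae_le (Lp.coeFn_add u v)]
      with x h1 h2 h3 h4 h5
    rw [h1, h4, Pi.add_apply, h2, h3, h5, Pi.add_apply, mul_add]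
  map_smul' c u := by
    ext1
    filter_upwards [(memLp_normSq_mul (c • u)).coeFn_toLp, (memLp_normSq_mul u).coeFn_toLp,
      Lp.coeFn_smul c ((memLp_normSq_mul u).toLp _),
      mulHaarH_absolutelyContinuous.ae_le (Lp.coeFn_smul c u)] with x h1 h2 h3 h4
    rw [RingHom.id_apply, h1, h3, Pi.smul_apply, h2, h4, Pi.smul_apply, smul_eq_mul, smul_eq_mul,
      mul_left_comm]
  norm_map' u := by
    change ‖(memLp_normSq_mul u).toLp _‖ = _
    rw [Lp.norm_toLp, eLpNorm_normSq_mul u, Lp.norm_def]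

lemma coeFn_normSqMulLI (u : Lp ℂ 2 muH) :
    normSqMulLI u =ᵐ[mulHaarH] fun x => ((normSq x : ℝ) : ℂ) * u x :=
  (memLp_normSq_mul u).coeFn_toLp

lemma normSqMulLI_surjective : Function.Surjective normSqMulLI := by
  intro v
  have hv := (Lp.stronglyMeasurable v).measurable
  have hfm : Measurable fun x => ((normSq x : ℝ) : ℂ)⁻¹ * v x :=
    (Complex.measurable_ofReal.comp Quaternion.continuous_normSq.measurable).inv.mul hv
  have hfv : (fun x => ((normSq x : ℝ) : ℂ) * (((normSq x : ℝ) : ℂ)⁻¹ * v x)) =ᵐ[mulHaarH] v := by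
    filter_upwards [isUnimodularOnUnits_mulHaarH.ae_ne_zero] with x hx
    rw [mul_inv_cancel_left₀]
    simpa using hx
  have hf : MemLp (fun x => ((normSq x : ℝ) : ℂ)⁻¹ * v x) 2 muH := by
    refine ⟨hfm.aestronglyMeasurable, ?_⟩
    rw [← eLpNorm_normSq_mul, eLpNorm_congr_ae hfv]
    exact (Lp.memLp v).2
  refine ⟨hf.toLp _, ?_⟩
  ext1
  filter_upwards [coeFn_normSqMulLI (hf.toLp _), hfv,
    mulHaarH_absolutelyContinuous.ae_le hf.coeFn_toLp] with x h1 h2 h3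
  rw [h1, h3, h2]

lemma normSqMulLI_apply_eq_comp {u w : Lp ℂ 2 muH} {f : ℍ[ℝ] → ℍ[ℝ]} {g : ℍ[ℝ]}
    (hf : MeasurePreserving f mulHaarH mulHaarH) (hfg : ∀ x, normSq (f x) = normSq g * normSq x)
    (hw : w =ᵐ[muH] fun x => ((normSq g : ℝ) : ℂ) * u (f x)) :
    normSqMulLI w = Lp.compMeasurePreserving f hf (normSqMulLI u) := by
  ext1
  filter_upwards [coeFn_normSqMulLI w, mulHaarH_absolutelyContinuous.ae_le hw,
    Lp.coeFn_compMeasurePreserving (normSqMulLI u) hf,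
    hf.quasiMeasurePreserving.ae (coeFn_normSqMulLI u)] with x h1 h2 h3 h4
  rw [h1, h2, h3, Function.comp, h4, hfg]
  push_cast
  ring

/-- Conjugation by the isometry `normSqMulLI`. -/
def conjNormSqMul (A : Lp ℂ 2 muH →L[ℂ] Lp ℂ 2 muH) : Lp ℂ 2 mulHaarH →L[ℂ] Lp ℂ 2 mulHaarH :=
  let U := LinearIsometryEquiv.ofSurjective normSqMulLI normSqMulLI_surjective
  (U.toContinuousLinearEquiv : Lp ℂ 2 muH →L[ℂ] Lp ℂ 2 mulHaarH) ∘L A ∘L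
    (U.symm.toContinuousLinearEquiv : Lp ℂ 2 mulHaarH →L[ℂ] Lp ℂ 2 muH)

lemma conjNormSqMul_apply (A : Lp ℂ 2 muH →L[ℂ] Lp ℂ 2 muH) (u : Lp ℂ 2 muH) :
    conjNormSqMul A (normSqMulLI u) = normSqMulLI (A u) := by
  have : (LinearIsometryEquiv.ofSurjective normSqMulLI normSqMulLI_surjective).symm
      (normSqMulLI u) = u :=
    (LinearIsometryEquiv.ofSurjective normSqMulLI normSqMulLI_surjective).symm_apply_apply u
  change normSqMulLI (A _) = _
  exact congrArg (fun w => normSqMulLI (A w)) this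

lemma commutesWithTranslations_conjNormSqMul
    {Lop Rop : ∀ g : ℍ[ℝ], g ≠ 0 → (Lp ℂ 2 muH →L[ℂ] Lp ℂ 2 muH)}
    (hL : ∀ (g : ℍ[ℝ]) (hg : g ≠ 0) (φ : Lp ℂ 2 muH),
      (Lop g hg φ : ℍ[ℝ] → ℂ) =ᵐ[muH] fun x => ((normSq g : ℝ) : ℂ) * φ (x * g))
    (hR : ∀ (g : ℍ[ℝ]) (hg : g ≠ 0) (φ : Lp ℂ 2 muH),
      (Rop g hg φ : ℍ[ℝ] → ℂ) =ᵐ[muH] fun x => ((normSq g : ℝ) : ℂ) * φ (g * x))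
    {A : Lp ℂ 2 muH →L[ℂ] Lp ℂ 2 muH}
    (hA : ∀ (g : ℍ[ℝ]) (hg : g ≠ 0),
      A.comp (Lop g hg) = (Lop g hg).comp A ∧ A.comp (Rop g hg) = (Rop g hg).comp A) :
    IsUnimodularOnUnits.CommutesWithTranslations isUnimodularOnUnits_mulHaarH
      (conjNormSqMul A) where
  mul_left g hg v := by
    obtain ⟨u, rfl⟩ := normSqMulLI_surjective v
    have hmp := isUnimodularOnUnits_mulHaarH.mul_left g hg
    have key (u) := normSqMulLI_apply_eq_comp hmp (fun x => map_mul normSq g x) (hR g hg u)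
    rw [conjNormSqMul_apply, ← key, ← key, conjNormSqMul_apply]
    exact congrArg _ (DFunLike.congr_fun (hA g hg).2 u)
  mul_right g hg v := by
    obtain ⟨u, rfl⟩ := normSqMulLI_surjective v
    have hmp := isUnimodularOnUnits_mulHaarH.mul_right g hg
    have key (u) := normSqMulLI_apply_eq_comp hmp
      (fun x => (map_mul normSq x g).trans (mul_comm _ _)) (hL g hg u)
    rw [conjNormSqMul_apply, ← key, ← key, conjNormSqMul_apply]
    exact congrArg _ (DFunLike.congr_fun (hA g hg).1 u)

end Transfer

/-- **The commutant of the two-sided dilation action of `ℍ^×` on `L²(ℍ, dx)` is abelian.**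
Here `Lop g` and `Rop g` are the bounded operators on `L²(ℍ, dx)` implementing
`L₁(g) : φ(x) ↦ |g|^{1/2}φ(xg)` and `R₁(g) : φ(x) ↦ |g|^{1/2}φ(gx)` (with
`|g|^{1/2} = n(g)`); any two bounded operators commuting with all `Lop g` and all `Rop g`
commute with each other. -/
theorem stmt13
    (Lop Rop : ∀ g : ℍ[ℝ], g ≠ 0 → (Lp ℂ 2 muH →L[ℂ] Lp ℂ 2 muH))
    (hL : ∀ (g : ℍ[ℝ]) (hg : g ≠ 0) (φ : Lp ℂ 2 muH),
      (Lop g hg φ : ℍ[ℝ] → ℂ) =ᵐ[muH] fun x => ((normSq g : ℝ) : ℂ) * φ (x * g))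
    (hR : ∀ (g : ℍ[ℝ]) (hg : g ≠ 0) (φ : Lp ℂ 2 muH),
      (Rop g hg φ : ℍ[ℝ] → ℂ) =ᵐ[muH] fun x => ((normSq g : ℝ) : ℂ) * φ (g * x))
    (A B : Lp ℂ 2 muH →L[ℂ] Lp ℂ 2 muH)
    (hA : ∀ (g : ℍ[ℝ]) (hg : g ≠ 0),
      A.comp (Lop g hg) = (Lop g hg).comp A ∧ A.comp (Rop g hg) = (Rop g hg).comp A)
    (hB : ∀ (g : ℍ[ℝ]) (hg : g ≠ 0),
      B.comp (Lop g hg) = (Lop g hg).comp B ∧ B.comp (Rop g hg) = (Rop g hg).comp B) :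
    A.comp B = B.comp A := by
  have key := isUnimodularOnUnits_mulHaarH.comp_comm
    (commutesWithTranslations_conjNormSqMul hL hR hA)
    (commutesWithTranslations_conjNormSqMul hL hR hB)
  ext1 u
  refine normSqMulLI.injective ?_
  have := DFunLike.congr_fun key (normSqMulLI u)
  simpa only [ContinuousLinearMap.comp_apply, conjNormSqMul_apply] using this
end
end

section
/- For each N ≥ 0 and 0 ≤ j ≤ N, let ω_j(x) = \bar a^{N-j} \bar b^{j} e^{-2π n(x)} where x = a + bj ∈ ℍ with a, b ∈ ℂ. Then the quaternionic Fourier transform of ω_j is F(ω_j)(y) = (-1)^j i^N α^{N-j} \barβ^{j} e^{-2π n(y)}, where y = α + βj. -/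
open Quaternion MeasureTheory
open scoped Real Quaternion ENNReal ComplexConjugate

noncomputable section

/-- The quaternion `j`. -/
def qj : ℍ[ℝ] := ⟨0, 0, 1, 0⟩

/-- The first complex coordinate `a = x₀ + x₁ i` of a quaternion `x = a + b j`. -/
def ca (x : ℍ[ℝ]) : ℂ := ⟨x.re, x.imI⟩

/-- The second complex coordinate `b = x₂ + x₃ i` of a quaternion `x = a + b j`. -/
def cb (x : ℍ[ℝ]) : ℂ := ⟨x.imJ, x.imK⟩

/-- The Gaussian wave `e^{-2πx² + 4πiux}` on the real line. -/
def gaussWave (u x : ℝ) : ℂ :=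
  Complex.exp (-(2 * (π : ℂ)) * (x : ℂ) ^ 2 + 4 * (π : ℂ) * Complex.I * u * x)

theorem continuous_gaussWave (u : ℝ) : Continuous (gaussWave u) := by
  unfold gaussWave
  fun_prop

theorem norm_gaussWave (u x : ℝ) : ‖gaussWave u x‖ = Real.exp (-(2 * π) * x ^ 2) := by
  rw [gaussWave, Complex.norm_exp]
  congr 1
  simp [pow_two]

theorem hasDerivAt_gaussWave (u x : ℝ) :
    HasDerivAt (gaussWave u)
      ((-(4 * (π : ℂ)) * x + 4 * (π : ℂ) * Complex.I * u) * gaussWave u x) x := by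
  have hx : HasDerivAt (fun x : ℝ => (x : ℂ)) 1 x := Complex.ofRealCLM.hasDerivAt
  have h := (((hx.pow 2).const_mul (-(2 * (π : ℂ)))).add
    (hx.const_mul (4 * (π : ℂ) * Complex.I * u))).cexp
  refine h.congr_deriv ?_
  simp only [gaussWave, Pi.add_apply, Pi.pow_apply]
  push_cast
  ring

theorem integral_gaussWave (u : ℝ) :
    ∫ x, gaussWave u x = (1 / 2 : ℂ) ^ (1 / 2 : ℂ) * Complex.exp (-(2 * (π : ℂ)) * (u : ℂ) ^ 2) := by
  have hπ : (π : ℂ) ≠ 0 := Complex.ofReal_ne_zero.mpr Real.pi_ne_zero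
  have h := fourierIntegral_gaussian (b := 2 * (π : ℂ)) (by simp [Real.pi_pos])
    (4 * (π : ℂ) * u)
  convert h using 2
  · ext x
    rw [gaussWave, ← Complex.exp_add]
    congr 1
    ring
  · congr 1
    field_simp
  · congr 1
    field_simp
    ring

theorem integrable_pow_mul_gaussWave (k : ℕ) (u : ℝ) :
    Integrable fun x : ℝ => (x : ℂ) ^ k * gaussWave u x := by
  have h : Integrable fun x : ℝ => x ^ k * Real.exp (-(2 * π) * x ^ 2) := by
    simpa using integrable_rpow_mul_exp_neg_mul_sq (b := 2 * π) Real.two_pi_pos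
      (s := k) (by linarith [k.cast_nonneg (α := ℝ)])
  refine h.mono (by have := continuous_gaussWave u; fun_prop) (.of_forall fun x => ?_)
  simp [norm_gaussWave]

theorem integrable_pow_mul_pow_mul_gaussWave (m k l : ℕ) (u v : ℝ) :
    Integrable fun p : ℝ × ℝ => ((p.1 : ℂ) - Complex.I * p.2) ^ m *
      ((p.1 : ℂ) ^ k * (p.2 : ℂ) ^ l) * (gaussWave u p.1 * gaussWave v p.2) := by
  induction m generalizing k l with
  | zero =>
    refine ((integrable_pow_mul_gaussWave k u).mul_prod
      (integrable_pow_mul_gaussWave l v)).congr (.of_forall fun p => ?_)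
    simp only
    ring
  | succ m ih =>
    refine ((ih (k + 1) l).sub ((ih k (l + 1)).const_mul Complex.I)).congr
      (.of_forall fun p => ?_)
    simp only [Pi.sub_apply]
    ring

theorem integral_eq_zero_of_hasLineDerivAt {f f' : ℝ × ℝ → ℂ} {w : ℝ × ℝ}
    (hf : Integrable f) (hf' : Integrable f') (h : ∀ p, HasLineDerivAt ℝ f (f' p) p w) :
    ∫ p, f' p = 0 := by
  simpa using integral_bilinear_hasLineDerivAt_right_eq_neg_left_of_integrable (μ := volume)
    (f := fun _ => (1 : ℂ)) (f' := fun _ => 0) (g := f) (g' := f') (v := w)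
    (B := ContinuousLinearMap.mul ℝ ℂ) (by simp) (by simpa using hf') (by simpa using hf)
    (fun p _ => hasDerivAt_const _ _) (fun p _ => h p)

theorem hasLineDerivAt_pow_mul_gaussWave (m : ℕ) (u v : ℝ) (p w : ℝ × ℝ) :
    HasLineDerivAt ℝ
      (fun p : ℝ × ℝ => ((p.1 : ℂ) - Complex.I * p.2) ^ m * (gaussWave u p.1 * gaussWave v p.2))
      ((m * ((p.1 : ℂ) - Complex.I * p.2) ^ (m - 1) * (w.1 - Complex.I * w.2) +
        ((p.1 : ℂ) - Complex.I * p.2) ^ m *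
          ((-(4 * (π : ℂ)) * p.1 + 4 * (π : ℂ) * Complex.I * u) * w.1 +
            (-(4 * (π : ℂ)) * p.2 + 4 * (π : ℂ) * Complex.I * v) * w.2)) *
        (gaussWave u p.1 * gaussWave v p.2)) p w := by
  have hline (a b : ℝ) : HasDerivAt (fun t : ℝ => a + t * b) b 0 := by
    simpa using ((hasDerivAt_id (0 : ℝ)).mul_const b).const_add a
  have hz : HasDerivAt (fun t : ℝ => (((p.1 + t * w.1 : ℝ) : ℂ) -
      Complex.I * ((p.2 + t * w.2 : ℝ) : ℂ))) (w.1 - Complex.I * w.2) 0 :=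
    (hline p.1 w.1).ofReal_comp.sub ((hline p.2 w.2).ofReal_comp.const_mul _)
  have hg (u a b : ℝ) : HasDerivAt (fun t : ℝ => gaussWave u (a + t * b))
      (b • ((-(4 * (π : ℂ)) * a + 4 * (π : ℂ) * Complex.I * u) * gaussWave u a)) 0 := by
    have h := hasDerivAt_gaussWave u (a + 0 * b)
    have := HasDerivAt.scomp (0 : ℝ) h (hline a b)
    simpa using! this
  have h := (hz.pow m).mul ((hg u p.1 w.1).mul (hg v p.2 w.2))
  unfold HasLineDerivAt
  refine h.congr_deriv ?_
  simp
  ring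

theorem integral_pow_succ_mul_gaussWave (m : ℕ) (u v : ℝ) :
    ∫ p : ℝ × ℝ, ((p.1 : ℂ) - Complex.I * p.2) ^ (m + 1) * (gaussWave u p.1 * gaussWave v p.2) =
      Complex.I * (u - Complex.I * v) *
        ∫ p : ℝ × ℝ, ((p.1 : ℂ) - Complex.I * p.2) ^ m * (gaussWave u p.1 * gaussWave v p.2) := by
  have hint (n k l : ℕ) := integrable_pow_mul_pow_mul_gaussWave n k l u v
  have hF (n : ℕ) : Integrable fun p : ℝ × ℝ =>
      ((p.1 : ℂ) - Complex.I * p.2) ^ n * (gaussWave u p.1 * gaussWave v p.2) := by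
    simpa using hint n 0 0
  have hF' (w : ℝ × ℝ) := (((hF (m - 1)).const_mul (m * (w.1 - Complex.I * w.2))).add
    (((hint m 1 0).const_mul (-(4 * (π : ℂ)) * w.1)).add
      ((hint m 0 1).const_mul (-(4 * (π : ℂ)) * w.2)))).add
    ((hF m).const_mul (4 * (π : ℂ) * Complex.I * (u * w.1 + v * w.2)))
  have hD (w : ℝ × ℝ) := (hF' w).congr (.of_forall fun p => show _ =
      ((m * ((p.1 : ℂ) - Complex.I * p.2) ^ (m - 1) * (w.1 - Complex.I * w.2) +
        ((p.1 : ℂ) - Complex.I * p.2) ^ m *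
          ((-(4 * (π : ℂ)) * p.1 + 4 * (π : ℂ) * Complex.I * u) * w.1 +
            (-(4 * (π : ℂ)) * p.2 + 4 * (π : ℂ) * Complex.I * v) * w.2)) *
        (gaussWave u p.1 * gaussWave v p.2)) by simp only [Pi.add_apply]; ring)
  have hzero (w : ℝ × ℝ) := integral_eq_zero_of_hasLineDerivAt (hF m) (hD w)
    fun p => hasLineDerivAt_pow_mul_gaussWave m u v p w
  have hπ : (π : ℂ) ≠ 0 := Complex.ofReal_ne_zero.mpr Real.pi_ne_zero
  have hcomb : ∫ p : ℝ × ℝ, (-(4 * (π : ℂ)) *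
        (((p.1 : ℂ) - Complex.I * p.2) ^ (m + 1) * (gaussWave u p.1 * gaussWave v p.2)) +
      4 * (π : ℂ) * (Complex.I * (u - Complex.I * v)) *
        (((p.1 : ℂ) - Complex.I * p.2) ^ m * (gaussWave u p.1 * gaussWave v p.2))) = 0 := by
    have h := integral_sub (hD (1, 0)) ((hD (0, 1)).const_mul Complex.I)
    rw [integral_const_mul, hzero, hzero, mul_zero, sub_zero] at h
    rw [← h]
    refine integral_congr_ae (.of_forall fun p => ?_)
    simp only [Complex.ofReal_one, Complex.ofReal_zero]
    linear_combination (-(m * ((p.1 : ℂ) - Complex.I * p.2) ^ (m - 1) *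
      (gaussWave u p.1 * gaussWave v p.2))) * Complex.I_sq
  rw [integral_add ((hF (m + 1)).const_mul _) ((hF m).const_mul _), integral_const_mul,
    integral_const_mul] at hcomb
  have : 4 * (π : ℂ) ≠ 0 := mul_ne_zero (by norm_num) hπ
  apply mul_left_cancel₀ this
  linear_combination -hcomb

theorem integral_pow_mul_gaussWave (m : ℕ) (u v : ℝ) :
    ∫ p : ℝ × ℝ, ((p.1 : ℂ) - Complex.I * p.2) ^ m * (gaussWave u p.1 * gaussWave v p.2) =
      1 / 2 * (Complex.I * (u - Complex.I * v)) ^ m *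
        Complex.exp (-(2 * (π : ℂ)) * ((u : ℂ) ^ 2 + (v : ℂ) ^ 2)) := by
  induction m with
  | zero =>
    have hsqrt : (1 / 2 : ℂ) ^ (1 / 2 : ℂ) * (1 / 2 : ℂ) ^ (1 / 2 : ℂ) = 1 / 2 := by
      rw [← Complex.cpow_add _ _ (by norm_num)]
      norm_num
    simp only [pow_zero, one_mul, mul_one]
    rw [Measure.volume_eq_prod, integral_prod_mul, integral_gaussWave, integral_gaussWave,
      mul_add, Complex.exp_add]
    linear_combination (Complex.exp (-(2 * (π : ℂ)) * (u : ℂ) ^ 2) *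
      Complex.exp (-(2 * (π : ℂ)) * (v : ℂ) ^ 2)) * hsqrt
  | succ m ih =>
    rw [integral_pow_succ_mul_gaussWave, ih]
    ring

/-- The quaternion with the given real coordinates. -/
def ofCoords (a b c d : ℝ) : ℍ[ℝ] := ⟨a, b, c, d⟩

@[simp]
theorem re_ofCoords (a b c d : ℝ) : (ofCoords a b c d).re = a := rfl

@[simp]
theorem imI_ofCoords (a b c d : ℝ) : (ofCoords a b c d).imI = b := rfl

@[simp]
theorem imJ_ofCoords (a b c d : ℝ) : (ofCoords a b c d).imJ = c := rfl

@[simp]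
theorem imK_ofCoords (a b c d : ℝ) : (ofCoords a b c d).imK = d := rfl

theorem coe_add_coe_mul_qj (α β : ℂ) :
    (α : ℍ[ℝ]) + (β : ℍ[ℝ]) * qj = ofCoords α.re α.im β.re β.im := by
  have hj : qj = ofCoords 0 0 1 0 := rfl
  ext <;> simp [hj]

theorem measurePreserving_equivTuple_symm :
    MeasurePreserving (fun v : Fin 4 → ℝ => (Quaternion.equivTuple ℝ).symm v) volume qLeb :=
  ⟨(Quaternion.linearIsometryEquivTuple.symm.continuous.comp
    (PiLp.continuous_toLp 2 fun _ : Fin 4 => ℝ)).measurable, rfl⟩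

theorem integral_fin_four (f : ℝ → ℝ → ℝ → ℝ → ℂ) :
    ∫ v : Fin 4 → ℝ, f (v 0) (v 1) (v 2) (v 3) =
      ∫ p : (ℝ × ℝ) × (ℝ × ℝ), f p.1.1 p.1.2 p.2.1 p.2.2 := by
  have h₄ := (volume_preserving_piFinSuccAbove (fun _ : Fin 4 => ℝ) 0).integral_comp'
    fun q => f q.1 (q.2 0) (q.2 1) (q.2 2)
  have h₃ := ((MeasurePreserving.id (volume : Measure ℝ)).prod
    (volume_preserving_piFinSuccAbove (fun _ : Fin 3 => ℝ) 0)).integral_comp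
    (MeasurableEmbedding.id.prodMap (MeasurableEquiv.measurableEmbedding _))
    fun q => f q.1 q.2.1 (q.2.2 0) (q.2.2 1)
  have h₂ := ((MeasurePreserving.id (volume : Measure ℝ)).prod
    ((MeasurePreserving.id (volume : Measure ℝ)).prod
      (volume_preserving_finTwoArrow ℝ))).integral_comp
    (MeasurableEmbedding.id.prodMap
      (MeasurableEmbedding.id.prodMap (MeasurableEquiv.measurableEmbedding _)))
    fun q => f q.1 q.2.1 q.2.2.1 q.2.2.2
  have h₁ := (MeasurePreserving.mk (MeasurableEquiv.prodAssoc.measurable)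
    (Measure.prodAssoc_prod (μ := (volume : Measure ℝ)) (ν := (volume : Measure ℝ))
      (τ := (volume : Measure (ℝ × ℝ))))).integral_comp'
    fun q => f q.1 q.2.1 q.2.2.1 q.2.2.2
  exact h₄.trans (h₃.trans (h₂.trans h₁.symm))

theorem integral_muH {f : ℍ[ℝ] → ℂ} (hf : Continuous f) :
    ∫ x, f x ∂muH = 4 * ∫ p : (ℝ × ℝ) × (ℝ × ℝ), f (ofCoords p.1.1 p.1.2 p.2.1 p.2.2) := by
  rw [muH, integral_smul_measure, ← measurePreserving_equivTuple_symm.map_eq,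
    integral_map measurePreserving_equivTuple_symm.aemeasurable hf.aestronglyMeasurable,
    ← integral_fin_four fun a b c d => f (ofCoords a b c d)]
  simp only [ENNReal.toReal_ofNat, Complex.real_smul, Complex.ofReal_ofNat]
  rfl

theorem continuous_ca : Continuous ca := by
  have h : ca = fun x : ℍ[ℝ] => (x.re : ℂ) + x.imI * Complex.I := by
    ext x
    exact Complex.mk_eq_add_mul_I _ _
  have := Quaternion.continuous_re
  have := Quaternion.continuous_imI
  rw [h]
  fun_prop

theorem continuous_cb : Continuous cb := by
  have h : cb = fun x : ℍ[ℝ] => (x.imJ : ℂ) + x.imK * Complex.I := by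
    ext x
    exact Complex.mk_eq_add_mul_I _ _
  have := Quaternion.continuous_imJ
  have := Quaternion.continuous_imK
  rw [h]
  fun_prop

/-- **Fourier transform of the Gaussian-type functions `ω_j`.**
For `0 ≤ j ≤ N` and `ω_j(x) = conj(a)^{N-j} conj(b)^j e^{-2π n(x)}` (`x = a + bj`), the
quaternionic Fourier transform (character `λ(x) = e^{-4πi Re x}`, self-dual measure
`4dx₀dx₁dx₂dx₃`) is `F(ω_j)(y) = (-1)^j i^N α^{N-j} conj(β)^j e^{-2π n(y)}` for
`y = α + βj`. -/
theorem stmt14 (N j : ℕ) (hj : j ≤ N) (α β : ℂ) :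
    ∫ x : ℍ[ℝ],
        (conj (ca x)) ^ (N - j) * (conj (cb x)) ^ j *
          Complex.exp (-(2 * (π : ℂ) * (normSq x : ℝ))) *
          Complex.exp (4 * (π : ℂ) * Complex.I *
            (((x * ((α : ℍ[ℝ]) + (β : ℍ[ℝ]) * qj)).re : ℝ) : ℂ)) ∂muH =
      (-1) ^ j * Complex.I ^ N * α ^ (N - j) * (conj β) ^ j *
        Complex.exp (-(2 * (π : ℂ) * (normSq ((α : ℍ[ℝ]) + (β : ℍ[ℝ]) * qj) : ℝ))) := by
  have hcont : Continuous fun x : ℍ[ℝ] => (conj (ca x)) ^ (N - j) * (conj (cb x)) ^ j *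
      Complex.exp (-(2 * (π : ℂ) * (normSq x : ℝ))) *
      Complex.exp (4 * (π : ℂ) * Complex.I *
        (((x * ((α : ℍ[ℝ]) + (β : ℍ[ℝ]) * qj)).re : ℝ) : ℂ)) := by
    have hre : Continuous fun x : ℍ[ℝ] => (x * ((α : ℍ[ℝ]) + (β : ℍ[ℝ]) * qj)).re :=
      Quaternion.continuous_re.comp (continuous_id.mul continuous_const)
    have := continuous_ca
    have := continuous_cb
    have := Quaternion.continuous_normSq
    fun_prop
  have hsplit (p : (ℝ × ℝ) × (ℝ × ℝ)) :
      (conj (ca (ofCoords p.1.1 p.1.2 p.2.1 p.2.2))) ^ (N - j) *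
          (conj (cb (ofCoords p.1.1 p.1.2 p.2.1 p.2.2))) ^ j *
        Complex.exp (-(2 * (π : ℂ) * (normSq (ofCoords p.1.1 p.1.2 p.2.1 p.2.2) : ℝ))) *
        Complex.exp (4 * (π : ℂ) * Complex.I *
          ((((ofCoords p.1.1 p.1.2 p.2.1 p.2.2) *
            ((α : ℍ[ℝ]) + (β : ℍ[ℝ]) * qj)).re : ℝ) : ℂ)) =
      (((p.1.1 : ℂ) - Complex.I * p.1.2) ^ (N - j) *
          (gaussWave α.re p.1.1 * gaussWave (-α.im) p.1.2)) *
        (((p.2.1 : ℂ) - Complex.I * p.2.2) ^ j *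
          (gaussWave (-β.re) p.2.1 * gaussWave (-β.im) p.2.2)) := by
    have ha : conj (ca (ofCoords p.1.1 p.1.2 p.2.1 p.2.2)) = (p.1.1 : ℂ) - Complex.I * p.1.2 := by
      apply Complex.ext <;> simp [ca]
    have hb : conj (cb (ofCoords p.1.1 p.1.2 p.2.1 p.2.2)) = (p.2.1 : ℂ) - Complex.I * p.2.2 := by
      apply Complex.ext <;> simp [cb]
    have hexp : Complex.exp (-(2 * (π : ℂ) *
          (normSq (ofCoords p.1.1 p.1.2 p.2.1 p.2.2) : ℝ))) *
        Complex.exp (4 * (π : ℂ) * Complex.I *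
          ((((ofCoords p.1.1 p.1.2 p.2.1 p.2.2) *
            ((α : ℍ[ℝ]) + (β : ℍ[ℝ]) * qj)).re : ℝ) : ℂ)) =
        gaussWave α.re p.1.1 * gaussWave (-α.im) p.1.2 *
          (gaussWave (-β.re) p.2.1 * gaussWave (-β.im) p.2.2) := by
      simp only [gaussWave, ← Complex.exp_add]
      congr 1
      simp [normSq_def', coe_add_coe_mul_qj]
      ring
    rw [ha, hb, mul_assoc, hexp]
    ring
  have hα : ((α.re : ℝ) : ℂ) - Complex.I * ((-α.im : ℝ) : ℂ) = α := by
    apply Complex.ext <;> simp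
  have hβ : ((-β.re : ℝ) : ℂ) - Complex.I * ((-β.im : ℝ) : ℂ) = -conj β := by
    apply Complex.ext <;> simp
  have hnorm : (normSq ((α : ℍ[ℝ]) + (β : ℍ[ℝ]) * qj) : ℝ) =
      α.re ^ 2 + (-α.im) ^ 2 + ((-β.re) ^ 2 + (-β.im) ^ 2) := by
    simp [normSq_def', coe_add_coe_mul_qj]
    ring
  have hI : Complex.I ^ N = Complex.I ^ (N - j) * Complex.I ^ j := by
    rw [← pow_add, Nat.sub_add_cancel hj]
  have hexp : Complex.exp (-(2 * (π : ℂ) * (normSq ((α : ℍ[ℝ]) + (β : ℍ[ℝ]) * qj) : ℝ))) =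
      Complex.exp (-(2 * (π : ℂ)) * (((α.re : ℝ) : ℂ) ^ 2 + ((-α.im : ℝ) : ℂ) ^ 2)) *
        Complex.exp (-(2 * (π : ℂ)) * (((-β.re : ℝ) : ℂ) ^ 2 + ((-β.im : ℝ) : ℂ) ^ 2)) := by
    rw [← Complex.exp_add, hnorm]
    congr 1
    push_cast
    ring
  rw [integral_muH hcont, integral_congr_ae (.of_forall hsplit), Measure.volume_eq_prod (ℝ × ℝ),
    integral_prod_mul (fun q : ℝ × ℝ => ((q.1 : ℂ) - Complex.I * q.2) ^ (N - j) *
      (gaussWave α.re q.1 * gaussWave (-α.im) q.2))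
      (fun q : ℝ × ℝ => ((q.1 : ℂ) - Complex.I * q.2) ^ j *
      (gaussWave (-β.re) q.1 * gaussWave (-β.im) q.2)),
    integral_pow_mul_gaussWave, integral_pow_mul_gaussWave, hα, hβ, hexp, hI,
    mul_neg, neg_pow (Complex.I * conj β), mul_pow, mul_pow]
  ring
end
end

section
/- The Fourier transform of the tempered distribution -log|y| on ℍ (with |y| = n(y)², Fourier transform relative to λ(x) = e^{-4πi x₀} and self-dual measure dx = 4dx₀dx₁dx₂dx₃) is the distribution G given by G(φ) = ∫_{|x|≤1}(φ(x) - φ(0)) dx/(2π²|x|) + ∫_{|x|>1} φ(x) dx/(2π²|x|) + (4log(2π) + 4γ_e - 2)φ(0), where γ_e is the Euler–Mascheroni constant. -/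
open Quaternion MeasureTheory
open scoped Real Quaternion ENNReal

noncomputable section

/-- The quaternionic Fourier transform with respect to `λ(x) = e^{-4πi Re x}`. -/
def Fq (φ : ℍ[ℝ] → ℂ) (y : ℍ[ℝ]) : ℂ :=
  ∫ x : ℍ[ℝ], φ x * Complex.exp (4 * (π : ℂ) * Complex.I * ((x * y).re : ℝ)) ∂muH

section LogIntegrals

open Set Filter Topology Asymptotics

theorem integrableOn_and_integral_log_mul_exp_neg :
    IntegrableOn (fun t : ℝ => Real.log t * Real.exp (-t)) (Ioi 0) ∧
      ∫ t in Ioi (0 : ℝ), Real.log t * Real.exp (-t) = -Real.eulerMascheroniConstant := by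
  have key := mellin_hasDerivAt_of_isBigO_rpow (E := ℂ) (f := fun x : ℝ => (Real.exp (-x) : ℂ))
    (s := 1) (a := 2) (b := 0) ?_ ?_ (by norm_num) ?_ (by norm_num)
  · have hI : IntegrableOn (fun t : ℝ => ((Real.log t * Real.exp (-t) : ℝ) : ℂ)) (Ioi 0) := by
      simpa [MellinConvergent] using key.1
    refine ⟨hI.re, ?_⟩
    have h1 := Complex.hasDerivAt_GammaIntegral (s := 1) (by simp)
    have h2 : HasDerivAt Complex.Gamma
        (∫ t : ℝ in Ioi 0, (t : ℂ) ^ ((1 : ℂ) - 1) * (Real.log t * Real.exp (-t))) 1 := by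
      apply h1.congr_of_eventuallyEq
      filter_upwards [(isOpen_lt continuous_const Complex.continuous_re).mem_nhds
        (show (0 : ℝ) < (1 : ℂ).re by simp)] with s hs using Complex.Gamma_eq_integral hs
    have h3 := h2.unique Complex.hasDerivAt_Gamma_one
    simp only [sub_self, Complex.cpow_zero, one_mul] at h3
    have h4 : ((∫ t in Ioi (0 : ℝ), Real.log t * Real.exp (-t) : ℝ) : ℂ)
        = ((-Real.eulerMascheroniConstant : ℝ) : ℂ) := by
      rw [← integral_complex_ofReal]
      push_cast
      exact_mod_cast h3
    exact_mod_cast h4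
  · refine (Continuous.continuousOn ?_).locallyIntegrableOn measurableSet_Ioi
    fun_prop
  · rw [← isBigO_norm_left]
    simp_rw [Complex.norm_real, isBigO_norm_left]
    simpa only [neg_one_mul] using (isLittleO_exp_neg_mul_rpow_atTop zero_lt_one _).isBigO
  · simp_rw [neg_zero, Real.rpow_zero]
    refine isBigO_const_of_tendsto (?_ : Tendsto _ _ (𝓝 (1 : ℂ))) one_ne_zero
    have : Continuous fun x : ℝ => (Real.exp (-x) : ℂ) := by fun_prop
    simpa using (this.tendsto 0).mono_left nhdsWithin_le_nhds

theorem integrableOn_exp_neg_mul_Ioi {A : ℝ} (hA : 0 < A) :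
    IntegrableOn (fun t : ℝ => Real.exp (-(A * t))) (Ioi 0) := by
  simpa only [neg_mul] using integrableOn_exp_mul_Ioi (neg_neg_of_pos hA) 0

theorem integral_exp_neg_mul_Ioi {A : ℝ} (hA : 0 < A) :
    ∫ t in Ioi (0 : ℝ), Real.exp (-(A * t)) = A⁻¹ := by
  simpa [neg_mul] using integral_exp_mul_Ioi (neg_neg_of_pos hA) 0

theorem integrableOn_and_integral_log_mul_exp_neg_mul {A : ℝ} (hA : 0 < A) :
    IntegrableOn (fun t : ℝ => Real.log t * Real.exp (-(A * t))) (Ioi 0) ∧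
      ∫ t in Ioi (0 : ℝ), Real.log t * Real.exp (-(A * t)) =
        -(Real.eulerMascheroniConstant + Real.log A) / A := by
  obtain ⟨hi, hv⟩ := integrableOn_and_integral_log_mul_exp_neg
  have hs := (integrableOn_Ioi_comp_mul_left_iff
    (fun t : ℝ => Real.log t * Real.exp (-t)) 0 hA).2 (by simpa using hi)
  have hc := (integrableOn_exp_neg_mul_Ioi hA).const_mul (Real.log A)
  have heq : EqOn (fun t : ℝ => Real.log t * Real.exp (-(A * t)))
      (fun t => Real.log (A * t) * Real.exp (-(A * t)) - Real.log A * Real.exp (-(A * t)))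
      (Ioi 0) := fun t ht => by
    simp only
    rw [Real.log_mul hA.ne' (ne_of_gt ht)]
    ring
  refine ⟨(integrableOn_congr_fun heq measurableSet_Ioi).2 (hs.sub hc), ?_⟩
  rw [setIntegral_congr_fun measurableSet_Ioi heq, integral_sub hs hc,
    integral_comp_mul_left_Ioi (fun t : ℝ => Real.log t * Real.exp (-t)) 0 hA, mul_zero, hv,
    integral_const_mul, integral_exp_neg_mul_Ioi hA, smul_eq_mul]
  field_simp
  ring

theorem integrableOn_and_integral_log_mul_exp_neg_div {A : ℝ} (hA : 0 < A) :
    IntegrableOn (fun t : ℝ => A / t ^ 2 * Real.exp (-(A / t)) * Real.log t) (Ioi 0) ∧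
      ∫ t in Ioi (0 : ℝ), A / t ^ 2 * Real.exp (-(A / t)) * Real.log t =
        Real.eulerMascheroniConstant + Real.log A := by
  obtain ⟨hi, hv⟩ := integrableOn_and_integral_log_mul_exp_neg_mul hA
  have heq : EqOn (fun t : ℝ => A / t ^ 2 * Real.exp (-(A / t)) * Real.log t)
      (fun t => -A * ((|(-1 : ℝ)| * t ^ ((-1 : ℝ) - 1)) •
        (Real.log (t ^ (-1 : ℝ)) * Real.exp (-(A * t ^ (-1 : ℝ)))))) (Ioi 0) := fun t ht => by
    have h2 : t ^ ((-1 : ℝ) - 1) = (t ^ 2)⁻¹ := by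
      rw [show (-1 : ℝ) - 1 = -((2 : ℕ) : ℝ) by norm_num, Real.rpow_neg (le_of_lt ht),
        Real.rpow_natCast]
    simp only [h2, Real.rpow_neg_one, Real.log_inv, abs_neg, abs_one, smul_eq_mul]
    ring_nf
  have hs := ((integrableOn_Ioi_comp_rpow_iff
    (fun t : ℝ => Real.log t * Real.exp (-(A * t))) (p := -1) (by norm_num)).2 hi).const_mul (-A)
  refine ⟨(integrableOn_congr_fun heq measurableSet_Ioi).2 hs, ?_⟩
  rw [setIntegral_congr_fun measurableSet_Ioi heq, integral_const_mul,
    integral_comp_rpow_Ioi (fun t : ℝ => Real.log t * Real.exp (-(A * t))) (by norm_num), hv]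
  field_simp

theorem exp_neg_le_inv {x : ℝ} (hx : 0 < x) : Real.exp (-x) ≤ x⁻¹ := by
  rw [Real.exp_neg]
  exact inv_anti₀ hx (by linarith [Real.add_one_le_exp x])

theorem abs_one_sub_exp_sub_exp_le_mul {A B t : ℝ} (hA : 0 < A) (hB : 0 < B) (ht : 0 < t) :
    |1 - Real.exp (-(B * t)) - Real.exp (-(A / t))| ≤ (B + A⁻¹) * t := by
  have h1 := Real.add_one_le_exp (-(B * t))
  have h2 : Real.exp (-(B * t)) ≤ 1 := by simp; positivity
  have h3 := exp_neg_le_inv (div_pos hA ht)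
  have h4 := Real.exp_pos (-(A / t))
  have h5 : (A / t)⁻¹ = A⁻¹ * t := by field_simp
  have h6 : 0 < A⁻¹ * t := by positivity
  have h7 : 0 < B * t := by positivity
  rw [h5] at h3
  rw [abs_le]
  constructor <;> nlinarith

theorem abs_one_sub_exp_sub_exp_le_div {A B t : ℝ} (hA : 0 < A) (hB : 0 < B) (ht : 0 < t) :
    |1 - Real.exp (-(B * t)) - Real.exp (-(A / t))| ≤ (A + B⁻¹) / t := by
  have h := abs_one_sub_exp_sub_exp_le_mul hB hA (inv_pos.2 ht)
  rw [div_inv_eq_mul, ← div_eq_mul_inv, ← div_eq_mul_inv] at h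
  rwa [sub_right_comm]

theorem integrableOn_one_sub_exp_sub_exp_div {A B : ℝ} (hA : 0 < A) (hB : 0 < B) :
    IntegrableOn (fun t : ℝ => (1 - Real.exp (-(B * t)) - Real.exp (-(A / t))) * t⁻¹) (Ioi 0) := by
  have hm : Measurable
      (fun t : ℝ => (1 - Real.exp (-(B * t)) - Real.exp (-(A / t))) * t⁻¹) := by fun_prop
  rw [← Ioc_union_Ioi_eq_Ioi zero_le_one]
  refine IntegrableOn.union ?_ ?_
  · refine Integrable.mono' (g := fun _ => B + A⁻¹) (by simp) hm.aestronglyMeasurable ?_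
    filter_upwards [ae_restrict_mem measurableSet_Ioc] with t ht
    rw [norm_mul, Real.norm_eq_abs, norm_inv, Real.norm_of_nonneg ht.1.le, ← div_eq_mul_inv,
      div_le_iff₀ ht.1]
    exact abs_one_sub_exp_sub_exp_le_mul hA hB ht.1
  · refine Integrable.mono' (g := fun t => (A + B⁻¹) * t ^ (-2 : ℝ))
      ((integrableOn_Ioi_rpow_of_lt (by norm_num) one_pos).const_mul _)
      hm.aestronglyMeasurable ?_
    filter_upwards [ae_restrict_mem measurableSet_Ioi] with t ht
    have ht0 : 0 < t := one_pos.trans ht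
    rw [norm_mul, Real.norm_eq_abs, norm_inv, Real.norm_of_nonneg ht0.le, ← div_eq_mul_inv,
      div_le_iff₀ ht0, show (-2 : ℝ) = -((2 : ℕ) : ℝ) by norm_num, Real.rpow_neg ht0.le,
      Real.rpow_natCast]
    refine (abs_one_sub_exp_sub_exp_le_div hA hB ht0).trans_eq ?_
    field_simp

theorem integral_one_sub_exp_sub_exp_div {A B : ℝ} (hA : 0 < A) (hB : 0 < B) :
    ∫ t in Ioi (0 : ℝ), (1 - Real.exp (-(B * t)) - Real.exp (-(A / t))) * t⁻¹ =
      Real.log A + Real.log B + 2 * Real.eulerMascheroniConstant := by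
  obtain ⟨hi₁, hv₁⟩ := integrableOn_and_integral_log_mul_exp_neg_mul hB
  obtain ⟨hi₂, hv₂⟩ := integrableOn_and_integral_log_mul_exp_neg_div hA
  have hi₁ := hi₁.const_mul B
  have hsub := hi₁.sub hi₂
  have heq : (fun t : ℝ => (B * Real.exp (-(B * t)) - A / t ^ 2 * Real.exp (-(A / t))) *
      Real.log t) = fun t => B * (Real.log t * Real.exp (-(B * t))) -
        A / t ^ 2 * Real.exp (-(A / t)) * Real.log t := by
    funext t
    ring
  have hbound : ∀ (l : Filter ℝ) (g : ℝ → ℝ), (∀ᶠ t in l,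
      |1 - Real.exp (-(B * t)) - Real.exp (-(A / t))| ≤ g t) →
      Tendsto (fun t => g t * |Real.log t|) l (𝓝 0) →
      Tendsto ((fun t => 1 - Real.exp (-(B * t)) - Real.exp (-(A / t))) * Real.log) l (𝓝 0) := by
    intro l g hg h0
    refine squeeze_zero_norm' ?_ h0
    filter_upwards [hg] with t ht
    rw [Pi.mul_apply, norm_mul]
    exact mul_le_mul_of_nonneg_right ht (abs_nonneg _)
  rw [integral_Ioi_mul_deriv_eq_deriv_mul (a' := 0) (b' := 0)
    (u := fun t => 1 - Real.exp (-(B * t)) - Real.exp (-(A / t)))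
    (u' := fun t => B * Real.exp (-(B * t)) - A / t ^ 2 * Real.exp (-(A / t)))
    (v := Real.log) ?_ (fun t ht => Real.hasDerivAt_log (ne_of_gt ht))
    (integrableOn_one_sub_exp_sub_exp_div hA hB) (by rw [Pi.mul_def, heq]; exact hsub) ?_ ?_, heq,
    integral_sub hi₁ hi₂, integral_const_mul, hv₁, hv₂]
  · field_simp
    ring
  · intro t ht
    have ht : t ≠ 0 := ne_of_gt ht
    have h1 := (((hasDerivAt_id t).const_mul B).neg).exp
    have h2 := ((((hasDerivAt_inv ht).const_mul A)).neg).exp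
    refine ((h1.const_sub 1).sub h2).congr_deriv ?_
    simp only [Pi.neg_apply, id, ← div_eq_mul_inv]
    ring
  · refine hbound _ (fun t => (B + A⁻¹) * t) ?_ ?_
    · filter_upwards [self_mem_nhdsWithin] with t ht
      exact abs_one_sub_exp_sub_exp_le_mul hA hB ht
    · have h := ((Real.continuous_mul_log.tendsto 0).mono_left
        (nhdsWithin_le_nhds (s := Ioi 0))).abs.const_mul (B + A⁻¹)
      simp only [zero_mul, abs_zero, mul_zero] at h
      refine h.congr' ?_
      filter_upwards [self_mem_nhdsWithin] with t ht
      rw [abs_mul, abs_of_pos ht]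
      ring
  · refine hbound _ (fun t => (A + B⁻¹) / t) ?_ ?_
    · filter_upwards [eventually_gt_atTop 0] with t ht
      exact abs_one_sub_exp_sub_exp_le_div hA hB ht
    · have h := (Real.isLittleO_log_id_atTop.tendsto_div_nhds_zero).abs.const_mul (A + B⁻¹)
      simp only [abs_zero, mul_zero] at h
      refine h.congr' ?_
      filter_upwards [eventually_gt_atTop 0] with t ht
      rw [abs_div, id, abs_of_pos ht]
      ring

theorem integrableOn_exp_neg_div_sub_exp_neg_div {a b : ℝ} (ha : 0 < a) (hb : 0 < b) :
    IntegrableOn (fun t : ℝ => (Real.exp (-(a / t)) - Real.exp (-(b / t))) * t⁻¹) (Ioi 0) := by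
  refine ((integrableOn_one_sub_exp_sub_exp_div hb one_pos).sub
    (integrableOn_one_sub_exp_sub_exp_div ha one_pos)).congr (.of_forall fun t => ?_)
  simp only [Pi.sub_apply]
  ring

theorem integral_exp_neg_div_sub_exp_neg_div {a b : ℝ} (ha : 0 < a) (hb : 0 < b) :
    ∫ t in Ioi (0 : ℝ), (Real.exp (-(a / t)) - Real.exp (-(b / t))) * t⁻¹ =
      Real.log b - Real.log a := by
  have h := integral_sub (integrableOn_one_sub_exp_sub_exp_div hb one_pos)
    (integrableOn_one_sub_exp_sub_exp_div ha one_pos)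
  rw [integral_one_sub_exp_sub_exp_div hb one_pos,
    integral_one_sub_exp_sub_exp_div ha one_pos] at h
  calc _ = _ := by
        congr 1
        funext t
        ring
    _ = _ := h
    _ = _ := by ring

theorem integral_norm_exp_neg_div_sub_exp_neg_div {a b : ℝ} (ha : 0 < a) (hb : 0 < b) :
    ∫ t in Ioi (0 : ℝ), ‖(Real.exp (-(a / t)) - Real.exp (-(b / t))) * t⁻¹‖ =
      |Real.log b - Real.log a| := by
  wlog hab : a ≤ b generalizing a b
  · rw [abs_sub_comm, ← this hb ha (le_of_not_ge hab)]
    congr 1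
    funext t
    rw [norm_mul, norm_mul, norm_sub_rev]
  rw [← integral_exp_neg_div_sub_exp_neg_div ha hb, abs_of_nonneg]
  · refine setIntegral_congr_fun measurableSet_Ioi fun t (ht : 0 < t) => ?_
    refine Real.norm_of_nonneg (mul_nonneg (sub_nonneg.2 ?_) (inv_nonneg.2 ht.le))
    gcongr
  · rw [integral_exp_neg_div_sub_exp_neg_div ha hb]
    exact sub_nonneg.2 (Real.log_le_log ha hab)

theorem integrableOn_one_sub_one_add_mul_exp_sub_exp_div {A B : ℝ} (hA : 0 < A) (hB : 0 < B) :
    IntegrableOn (fun t : ℝ =>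
      (1 - (1 + B * t) * Real.exp (-(B * t)) - Real.exp (-(A / t))) * t⁻¹) (Ioi 0) := by
  refine ((integrableOn_congr_fun (fun t ht => ?_) measurableSet_Ioi).1
    ((integrableOn_one_sub_exp_sub_exp_div hA hB).sub
      ((integrableOn_exp_neg_mul_Ioi hB).const_mul B)))
  have ht : t ≠ 0 := ne_of_gt ht
  simp only [Pi.sub_apply]
  field_simp
  ring

theorem integral_one_sub_one_add_mul_exp_sub_exp_div {A B : ℝ} (hA : 0 < A) (hB : 0 < B) :
    ∫ t in Ioi (0 : ℝ), (1 - (1 + B * t) * Real.exp (-(B * t)) - Real.exp (-(A / t))) * t⁻¹ =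
      Real.log A + Real.log B + 2 * Real.eulerMascheroniConstant - 1 := by
  have h := integral_sub (integrableOn_one_sub_exp_sub_exp_div hA hB)
    ((integrableOn_exp_neg_mul_Ioi hB).const_mul B)
  rw [integral_one_sub_exp_sub_exp_div hA hB, integral_const_mul, integral_exp_neg_mul_Ioi hB,
    mul_inv_cancel₀ hB.ne'] at h
  rw [← h]
  refine setIntegral_congr_fun measurableSet_Ioi fun t ht => ?_
  have ht : t ≠ 0 := ne_of_gt ht
  field_simp
  ring

/-- The kernel `u e^{-cu}` and its integral `1 / c²`. -/
theorem integrableOn_and_integral_mul_exp_neg_mul {c : ℝ} (hc : 0 < c) :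
    IntegrableOn (fun t : ℝ => t * Real.exp (-(c * t))) (Ioi 0) ∧
      ∫ t in Ioi (0 : ℝ), t * Real.exp (-(c * t)) = (c ^ 2)⁻¹ := by
  have hv := Real.integral_rpow_mul_exp_neg_mul_Ioi (a := 2) (by norm_num) hc
  have he : EqOn (fun t : ℝ => t ^ ((2 : ℝ) - 1) * Real.exp (-(c * t)))
      (fun t => t * Real.exp (-(c * t))) (Ioi 0) := fun t _ => by norm_num
  rw [setIntegral_congr_fun measurableSet_Ioi he, Real.Gamma_two, mul_one, one_div,
    Real.rpow_ofNat, inv_pow] at hv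
  refine ⟨Integrable.of_integral_ne_zero ?_, hv⟩
  rw [hv]
  positivity

end LogIntegrals

section FourDimensional

open Set Filter Topology FourierTransform Module

theorem SchwartzMap.exists_norm_sub_le {V : Type*} [NormedAddCommGroup V]
    [NormedSpace ℝ V] (φ : SchwartzMap V ℂ) :
    ∃ C : ℝ, 0 ≤ C ∧ ∀ x, ‖φ x - φ 0‖ ≤ C * ‖x‖ := by
  refine ⟨SchwartzMap.seminorm ℝ 0 1 φ, apply_nonneg _ _, fun x => ?_⟩
  have h := (convex_univ (𝕜 := ℝ) (E := V)).norm_image_sub_le_of_norm_fderiv_le (𝕜 := ℝ) (f := φ)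
    (C := SchwartzMap.seminorm ℝ 0 1 φ) (fun y _ => φ.differentiableAt)
    (fun y _ => by
      rw [← norm_iteratedFDeriv_one]
      exact φ.norm_iteratedFDeriv_le_seminorm ℝ 1 y) (mem_univ 0) (mem_univ x)
  simpa using h

variable {V : Type*} [NormedAddCommGroup V] [InnerProductSpace ℝ V] [FiniteDimensional ℝ V]
  [MeasurableSpace V] [BorelSpace V]

theorem integral_gaussian_mul_fourier (hV : finrank ℝ V = 4) (φ : SchwartzMap V ℂ) {u : ℝ}
    (hu : 0 < u) :
    ∫ w : V, (Real.exp (-(π * ‖w‖ ^ 2 / u)) : ℂ) * 𝓕 φ w =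
      (u : ℂ) ^ 2 * ∫ x : V, (Real.exp (-(π * ‖x‖ ^ 2 * u)) : ℂ) * φ x := by
  have hb : 0 < ((π / u : ℝ) : ℂ).re := by
    rw [Complex.ofReal_re]
    positivity
  have hg : Integrable (fun v : V => Complex.exp (-((π / u : ℝ) : ℂ) * ‖v‖ ^ 2)) := by
    simpa using GaussianFourier.integrable_cexp_neg_mul_sq_norm_add hb 0 (0 : V)
  have key := VectorFourier.integral_fourierIntegral_smul_eq_flip (L := innerₗ V) (μ := volume)
    (ν := volume) Real.continuous_fourierChar continuous_inner φ.integrable hg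
  have hflip : ∀ x : V, VectorFourier.fourierIntegral Real.fourierChar volume (innerₗ V).flip
      (fun v : V => Complex.exp (-((π / u : ℝ) : ℂ) * ‖v‖ ^ 2)) x =
      (u : ℂ) ^ 2 * (Real.exp (-(π * ‖x‖ ^ 2 * u)) : ℂ) := by
    intro x
    rw [flip_innerₗ]
    refine (fourier_gaussian_innerProductSpace hb x).trans ?_
    have hu' : (u : ℂ) ≠ 0 := by exact_mod_cast hu.ne'
    have hpi : (π : ℂ) ≠ 0 := by exact_mod_cast Real.pi_ne_zero
    have h4 : ((finrank ℝ V : ℕ) : ℂ) / 2 = (2 : ℕ) := by rw [hV]; norm_num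
    rw [h4, Complex.cpow_natCast]
    push_cast
    congr 2
    · field_simp
    · field_simp
  simp only [hflip, smul_eq_mul] at key
  rw [← integral_const_mul]
  calc _ = _ := by
        congr 1
        funext w
        rw [mul_comm]
        congr 2
        push_cast
        ring_nf
    _ = _ := key
    _ = _ := by
        congr 1
        funext w
        ring

theorem integral_fourier_schwartz (φ : SchwartzMap V ℂ) : ∫ w : V, 𝓕 φ w = φ 0 := by
  have h : (𝓕⁻ (𝓕 φ)) (0 : V) = φ 0 := by simp
  rw [SchwartzMap.fourierInv_coe, Real.fourierInv_eq'] at h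
  simpa using h

theorem integrable_indicator_inv_norm_pow_three (hV : finrank ℝ V = 4) :
    Integrable (fun x : V => (Iic (1 : ℝ)).indicator (fun r => (r ^ 3)⁻¹) ‖x‖) := by
  have : Nontrivial V := Module.nontrivial_of_finrank_pos (R := ℝ) (by omega)
  rw [integrable_fun_norm_addHaar volume (f := (Iic (1 : ℝ)).indicator fun r => (r ^ 3)⁻¹), hV]
  have h : IntegrableOn ((Iic (1 : ℝ)).indicator fun _ => (1 : ℝ)) (Ioi 0) := by
    rw [IntegrableOn, integrable_indicator_iff measurableSet_Iic, IntegrableOn,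
      Measure.restrict_restrict measurableSet_Iic, Iic_inter_Ioi]
    simp
  refine (integrableOn_congr_fun (fun y (hy : 0 < y) => ?_) measurableSet_Ioi).1 h
  by_cases h1 : y ≤ 1
  · simp [indicator, h1, hy.ne']
  · simp [indicator, h1]

theorem integral_ball_gaussian (hV : finrank ℝ V = 4) {u : ℝ} (hu : 0 < u) :
    ∫ x : V, (Iic (1 : ℝ)).indicator (fun r => Real.exp (-(π * r ^ 2 * u))) ‖x‖ =
      (1 - (1 + π * u) * Real.exp (-(π * u))) / u ^ 2 := by
  have : Nontrivial V := Module.nontrivial_of_finrank_pos (R := ℝ) (by omega)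
  rw [integral_fun_norm_addHaar volume
    (f := (Iic (1 : ℝ)).indicator fun r => Real.exp (-(π * r ^ 2 * u))), hV, Measure.real,
    InnerProductSpace.volume_ball_of_dim_even (k := 2) (by omega)]
  have hint : ∫ y in Ioi (0 : ℝ), y ^ (4 - 1) •
      (Iic (1 : ℝ)).indicator (fun r => Real.exp (-(π * r ^ 2 * u))) y =
      (1 - (1 + π * u) * Real.exp (-(π * u))) / (2 * π ^ 2 * u ^ 2) := by
    have hd : ∀ r ∈ uIcc (0 : ℝ) 1, HasDerivAt
        (fun r : ℝ => -(r ^ 2 + 1 / (π * u)) / (2 * π * u) * Real.exp (-(π * r ^ 2 * u)))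
        (r ^ 3 * Real.exp (-(π * r ^ 2 * u))) r := by
      intro r _
      have h1 := ((((hasDerivAt_pow 2 r).const_mul π).mul_const u).neg).exp
      have h2 := (((hasDerivAt_pow 2 r).add_const (1 / (π * u))).neg).div_const (2 * π * u)
      refine (h2.mul h1).congr_deriv ?_
      simp only [Pi.neg_apply]
      have := Real.pi_pos
      field_simp
      ring
    have hI := intervalIntegral.integral_eq_sub_of_hasDerivAt hd
      (Continuous.intervalIntegrable (by fun_prop) _ _)
    rw [intervalIntegral.integral_of_le zero_le_one] at hI
    calc _ = ∫ y in Ioc (0 : ℝ) 1, y ^ 3 * Real.exp (-(π * y ^ 2 * u)) := by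
          rw [← Ioi_inter_Iic, ← setIntegral_indicator measurableSet_Iic]
          congr 1
          funext y
          by_cases hy : y ≤ 1 <;> simp [indicator, hy]
      _ = _ := by
          rw [hI]
          have := Real.pi_pos
          norm_num
          field_simp
          ring
  rw [hint]
  have := Real.pi_pos
  norm_num
  rw [ENNReal.toReal_ofReal (by positivity)]
  field_simp
  ring

theorem SchwartzMap.integrable_log_norm_mul (hV : finrank ℝ V = 4) (φ : SchwartzMap V ℂ) :
    Integrable (fun w : V => (Real.log ‖w‖ : ℂ) * φ w) := by
  refine Integrable.mono' (((φ.integrable_pow_mul volume 1)).add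
    ((integrable_indicator_inv_norm_pow_three hV).mul_const (SchwartzMap.seminorm ℝ 0 0 φ)))
    ?_ (.of_forall fun w => ?_)
  · exact ((Complex.measurable_ofReal.comp (Real.measurable_log.comp measurable_norm)).mul
      φ.continuous.measurable).aestronglyMeasurable
  · rw [norm_mul, Complex.norm_real, Real.norm_eq_abs, Pi.add_apply, pow_one]
    have hC := φ.norm_le_seminorm ℝ w
    rcases eq_or_ne w 0 with rfl | hw
    · simp
    have hw : 0 < ‖w‖ := norm_pos_iff.2 hw
    by_cases h1 : ‖w‖ ≤ 1
    · rw [indicator_of_mem (show ‖w‖ ∈ Iic (1 : ℝ) from h1)]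
      refine le_add_of_nonneg_of_le (by positivity) ?_
      refine mul_le_mul ?_ hC (norm_nonneg _) (by positivity)
      rw [abs_of_nonpos (Real.log_nonpos hw.le h1), ← Real.log_inv]
      refine (Real.log_le_self (by positivity)).trans (inv_anti₀ (by positivity) ?_)
      exact pow_le_of_le_one hw.le h1 (by norm_num)
    · rw [indicator_of_notMem (show ‖w‖ ∉ Iic (1 : ℝ) from h1), zero_mul, add_zero,
        abs_of_nonneg (Real.log_nonneg (le_of_not_ge h1))]
      exact mul_le_mul_of_nonneg_right (Real.log_le_self hw.le) (norm_nonneg _)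

theorem integrable_complex_ofReal {α : Type*} [MeasurableSpace α] {μ : Measure α} {f : α → ℝ}
    (hf : Integrable f μ) : Integrable (fun x => (f x : ℂ)) μ :=
  hf.ofReal

theorem integral_log_mul_fourier_eq_integral_Ioi (hV : finrank ℝ V = 4) (φ : SchwartzMap V ℂ) :
    ∫ w : V, ((Real.log 4 - 2 * Real.log ‖w‖ : ℝ) : ℂ) * 𝓕 φ w =
      ∫ u in Ioi (0 : ℝ), ((u : ℂ) * (∫ x : V, (Real.exp (-(π * ‖x‖ ^ 2 * u)) : ℂ) * φ x) -
        (Real.exp (-(4 * π / u)) * u⁻¹ : ℝ) * φ 0) := by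
  have : Nontrivial V := Module.nontrivial_of_finrank_pos (R := ℝ) (by omega)
  have hpi := Real.pi_pos
  let k : V → ℝ → ℝ := fun w u =>
    (Real.exp (-(π * ‖w‖ ^ 2 / u)) - Real.exp (-(4 * π / u))) * u⁻¹
  have hlog : ∀ w : V, w ≠ 0 →
      Real.log (4 * π) - Real.log (π * ‖w‖ ^ 2) = Real.log 4 - 2 * Real.log ‖w‖ := by
    intro w hw
    have : ‖w‖ ≠ 0 := norm_ne_zero_iff.2 hw
    rw [Real.log_mul (by norm_num) hpi.ne', Real.log_mul hpi.ne' (by positivity), Real.log_pow]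
    push_cast
    ring
  have hne : ∀ᵐ w : V, w ≠ 0 := by
    simp [ae_iff, measure_singleton]
  have hpos : ∀ w : V, w ≠ 0 → 0 < π * ‖w‖ ^ 2 := fun w hw => by
    have := norm_pos_iff.2 hw
    positivity
  have hmeas : AEStronglyMeasurable (Function.uncurry fun (w : V) (u : ℝ) =>
      (k w u : ℂ) * 𝓕 φ w) (volume.prod (volume.restrict (Ioi 0))) := by
    have h1 : Measurable fun p : V × ℝ => k p.1 p.2 := by
      simp only [k]
      fun_prop
    have h2 : Measurable fun p : V × ℝ => 𝓕 φ p.1 :=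
      (𝓕 φ).continuous.measurable.comp measurable_fst
    exact ((Complex.measurable_ofReal.comp h1).mul h2).aestronglyMeasurable
  have hprod : Integrable (Function.uncurry fun (w : V) (u : ℝ) => (k w u : ℂ) * 𝓕 φ w)
      (volume.prod (volume.restrict (Ioi 0))) := by
    rw [integrable_prod_iff hmeas]
    constructor
    · filter_upwards [hne] with w hw
      exact (integrable_complex_ofReal (integrableOn_exp_neg_div_sub_exp_neg_div (hpos w hw)
        (by positivity : 0 < 4 * π))).mul_const (𝓕 φ w)
    · have h1 := ((𝓕 φ).integrable.const_mul ((Real.log 4 : ℝ) : ℂ)).sub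
        (((𝓕 φ).integrable_log_norm_mul hV).const_mul 2)
      refine h1.norm.congr ?_
      filter_upwards [hne] with w hw
      simp only [Function.uncurry, norm_mul, Complex.norm_real, integral_mul_const, k]
      have h2 := integral_norm_exp_neg_div_sub_exp_neg_div (hpos w hw)
        (by positivity : 0 < 4 * π)
      simp only [norm_mul] at h2
      rw [h2, hlog w hw, Pi.sub_apply, ← mul_assoc, ← sub_mul, norm_mul, ← Real.norm_eq_abs,
        ← Complex.norm_real]
      push_cast
      rfl
  calc _ = ∫ w : V, ∫ u in Ioi (0 : ℝ), (k w u : ℂ) * 𝓕 φ w := by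
        refine integral_congr_ae ?_
        filter_upwards [hne] with w hw
        rw [integral_mul_const, integral_complex_ofReal,
          integral_exp_neg_div_sub_exp_neg_div (hpos w hw) (by positivity : 0 < 4 * π), hlog w hw]
    _ = ∫ u in Ioi (0 : ℝ), ∫ w : V, (k w u : ℂ) * 𝓕 φ w := integral_integral_swap hprod
    _ = _ := by
        refine setIntegral_congr_fun measurableSet_Ioi fun u (hu : 0 < u) => ?_
        have hu' : (u : ℂ) ≠ 0 := by exact_mod_cast hu.ne'
        have hg : Integrable fun w : V => (Real.exp (-(π * ‖w‖ ^ 2 / u)) : ℂ) * 𝓕 φ w := by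
          refine (𝓕 φ).integrable.bdd_mul (c := 1) (by fun_prop) (.of_forall fun w => ?_)
          rw [Complex.norm_real, Real.norm_of_nonneg (Real.exp_pos _).le]
          simp only [Real.exp_le_one_iff, Left.neg_nonpos_iff]
          positivity
        have hsplit : ∀ w : V, (k w u : ℂ) * 𝓕 φ w =
            (u : ℂ)⁻¹ * ((Real.exp (-(π * ‖w‖ ^ 2 / u)) : ℂ) * 𝓕 φ w) -
              ((Real.exp (-(4 * π / u)) * u⁻¹ : ℝ) : ℂ) * 𝓕 φ w := by
          intro w
          simp only [k]
          push_cast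
          ring
        simp only [hsplit]
        rw [integral_sub (hg.const_mul _) ((𝓕 φ).integrable.const_mul _), integral_const_mul,
          integral_const_mul, integral_fourier_schwartz, integral_gaussian_mul_fourier hV φ hu,
          ← mul_assoc]
        congr 2
        field_simp

/-- `φ` with its value at `0` subtracted on the closed unit ball. -/
def subZeroOnBall (φ : SchwartzMap V ℂ) (x : V) : ℂ :=
  φ x - (Iic (1 : ℝ)).indicator (fun _ => φ 0) ‖x‖

theorem measurable_subZeroOnBall {V : Type*} [NormedAddCommGroup V] [InnerProductSpace ℝ V]
    [MeasurableSpace V] [BorelSpace V] (φ : SchwartzMap V ℂ) : Measurable (subZeroOnBall φ) :=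
  φ.continuous.measurable.sub
    ((measurable_const.indicator measurableSet_Iic).comp measurable_norm)

theorem integrable_subZeroOnBall_div (hV : finrank ℝ V = 4) (φ : SchwartzMap V ℂ) :
    Integrable fun x : V => subZeroOnBall φ x / ((‖x‖ ^ 4 : ℝ) : ℂ) := by
  obtain ⟨C, hC, hφ⟩ := φ.exists_norm_sub_le
  refine Integrable.mono' (((integrable_indicator_inv_norm_pow_three hV).const_mul C).add
    φ.integrable.norm) ?_ (.of_forall fun x => ?_)
  · have h : Measurable fun x : V => ((‖x‖ ^ 4 : ℝ) : ℂ) := by fun_prop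
    exact ((measurable_subZeroOnBall φ).div h).aestronglyMeasurable
  · rw [norm_div, Complex.norm_real, Real.norm_of_nonneg (by positivity), Pi.add_apply,
      subZeroOnBall]
    by_cases h1 : ‖x‖ ≤ 1
    · rw [indicator_of_mem (show ‖x‖ ∈ Iic (1 : ℝ) from h1),
        indicator_of_mem (show ‖x‖ ∈ Iic (1 : ℝ) from h1)]
      refine le_add_of_le_of_nonneg ?_ (norm_nonneg _)
      rcases eq_or_ne x 0 with rfl | hx
      · simp
      have hx : 0 < ‖x‖ := norm_pos_iff.2 hx
      rw [div_le_iff₀ (by positivity)]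
      refine (hφ x).trans_eq ?_
      field_simp
    · rw [indicator_of_notMem (show ‖x‖ ∉ Iic (1 : ℝ) from h1),
        indicator_of_notMem (show ‖x‖ ∉ Iic (1 : ℝ) from h1), mul_zero, zero_add, sub_zero]
      exact div_le_self (norm_nonneg _) (one_le_pow₀ (le_of_not_ge h1))

theorem integrable_subZeroOnBall (φ : SchwartzMap V ℂ) : Integrable (subZeroOnBall φ) := by
  refine φ.integrable.sub ?_
  have h : (fun x : V => (Iic (1 : ℝ)).indicator (fun _ => φ 0) ‖x‖) =
      (Metric.closedBall (0 : V) 1).indicator fun _ => φ 0 := by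
    funext x
    simp [indicator]
  rw [h, integrable_indicator_iff measurableSet_closedBall]
  exact integrableOn_const measure_closedBall_lt_top.ne

theorem integrable_and_integral_gaussian_mul_subZeroOnBall (hV : finrank ℝ V = 4)
    (φ : SchwartzMap V ℂ) :
    IntegrableOn (fun u : ℝ => ∫ x : V,
        ((u * Real.exp (-(π * ‖x‖ ^ 2 * u)) : ℝ) : ℂ) * subZeroOnBall φ x) (Ioi 0) ∧
      ∫ u in Ioi (0 : ℝ), ∫ x : V,
        ((u * Real.exp (-(π * ‖x‖ ^ 2 * u)) : ℝ) : ℂ) * subZeroOnBall φ x =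
      ((π ^ 2)⁻¹ : ℝ) * ∫ x : V, subZeroOnBall φ x / ((‖x‖ ^ 4 : ℝ) : ℂ) := by
  have : Nontrivial V := Module.nontrivial_of_finrank_pos (R := ℝ) (by omega)
  have hpi := Real.pi_pos
  have hne : ∀ᵐ w : V, w ≠ 0 := by
    simp [ae_iff, measure_singleton]
  have hpos : ∀ w : V, w ≠ 0 → 0 < π * ‖w‖ ^ 2 := fun w hw => by
    have := norm_pos_iff.2 hw
    positivity
  have hmeas : AEStronglyMeasurable (Function.uncurry fun (x : V) (u : ℝ) =>
      ((u * Real.exp (-(π * ‖x‖ ^ 2 * u)) : ℝ) : ℂ) * subZeroOnBall φ x)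
      (volume.prod (volume.restrict (Ioi 0))) := by
    have h1 : Measurable fun p : V × ℝ => p.2 * Real.exp (-(π * ‖p.1‖ ^ 2 * p.2)) := by
      fun_prop
    exact ((Complex.measurable_ofReal.comp h1).mul
      ((measurable_subZeroOnBall φ).comp measurable_fst)).aestronglyMeasurable
  have hprod : Integrable (Function.uncurry fun (x : V) (u : ℝ) =>
      ((u * Real.exp (-(π * ‖x‖ ^ 2 * u)) : ℝ) : ℂ) * subZeroOnBall φ x)
      (volume.prod (volume.restrict (Ioi 0))) := by
    rw [integrable_prod_iff hmeas]
    constructor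
    · filter_upwards [hne] with x hx
      exact (integrable_complex_ofReal
        (integrableOn_and_integral_mul_exp_neg_mul (hpos x hx)).1).mul_const (subZeroOnBall φ x)
    · refine ((integrable_subZeroOnBall_div hV φ).norm.const_mul (π ^ 2)⁻¹).congr ?_
      filter_upwards [hne] with x hx
      have h : ∀ u ∈ Ioi (0 : ℝ), ‖Function.uncurry (fun (x : V) (u : ℝ) =>
          ((u * Real.exp (-(π * ‖x‖ ^ 2 * u)) : ℝ) : ℂ) * subZeroOnBall φ x) (x, u)‖ =
          u * Real.exp (-(π * ‖x‖ ^ 2 * u)) * ‖subZeroOnBall φ x‖ := by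
        intro u (hu : 0 < u)
        rw [Function.uncurry, norm_mul, Complex.norm_real, Real.norm_of_nonneg (by positivity)]
      rw [setIntegral_congr_fun measurableSet_Ioi h, integral_mul_const,
        (integrableOn_and_integral_mul_exp_neg_mul (hpos x hx)).2, norm_div, Complex.norm_real,
        Real.norm_of_nonneg (by positivity)]
      have := norm_pos_iff.2 hx
      field_simp
  refine ⟨hprod.integral_prod_right, ?_⟩
  rw [← integral_integral_swap hprod, ← integral_const_mul]
  refine integral_congr_ae ?_
  filter_upwards [hne] with x hx
  rw [integral_mul_const, integral_complex_ofReal,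
    (integrableOn_and_integral_mul_exp_neg_mul (hpos x hx)).2]
  push_cast
  have : (‖x‖ : ℂ) ≠ 0 := by exact_mod_cast norm_ne_zero_iff.2 hx
  field_simp

theorem integral_log_mul_fourier (hV : finrank ℝ V = 4) (φ : SchwartzMap V ℂ) :
    ∫ w : V, ((Real.log 4 - 2 * Real.log ‖w‖ : ℝ) : ℂ) * 𝓕 φ w =
      ((π ^ 2)⁻¹ : ℝ) * (∫ x : V, subZeroOnBall φ x / ((‖x‖ ^ 4 : ℝ) : ℂ)) +
        ((2 * Real.log (2 * π) + 2 * Real.eulerMascheroniConstant - 1 : ℝ) : ℂ) * φ 0 := by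
  have hpi := Real.pi_pos
  obtain ⟨hi, hv⟩ := integrable_and_integral_gaussian_mul_subZeroOnBall hV φ
  have hi' := integrable_complex_ofReal (integrableOn_one_sub_one_add_mul_exp_sub_exp_div
    (by positivity : 0 < 4 * π) hpi)
  have hv' := integral_one_sub_one_add_mul_exp_sub_exp_div (by positivity : 0 < 4 * π) hpi
  have hconst : Real.log (4 * π) + Real.log π + 2 * Real.eulerMascheroniConstant - 1 =
      2 * Real.log (2 * π) + 2 * Real.eulerMascheroniConstant - 1 := by
    rw [← Real.log_mul (by positivity) (by positivity),
      show 4 * π * π = (2 * π) ^ 2 by ring, Real.log_pow]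
    push_cast
    ring
  rw [integral_log_mul_fourier_eq_integral_Ioi hV φ, ← hv, ← hconst, ← hv',
    ← integral_complex_ofReal, ← integral_mul_const,
    ← integral_add hi (hi'.mul_const (φ 0))]
  refine setIntegral_congr_fun measurableSet_Ioi fun u (hu : 0 < u) => ?_
  have hu' : (u : ℂ) ≠ 0 := by exact_mod_cast hu.ne'
  have hb : ∀ x : V, ‖(Real.exp (-(π * ‖x‖ ^ 2 * u)) : ℂ)‖ ≤ 1 := fun x => by
    rw [Complex.norm_real, Real.norm_of_nonneg (Real.exp_pos _).le]
    simp only [Real.exp_le_one_iff, Left.neg_nonpos_iff]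
    positivity
  have h1 : Integrable fun x : V => (Real.exp (-(π * ‖x‖ ^ 2 * u)) : ℂ) * subZeroOnBall φ x :=
    (integrable_subZeroOnBall φ).bdd_mul (c := 1) (by fun_prop) (.of_forall hb)
  have h2 : Integrable fun x : V => (Real.exp (-(π * ‖x‖ ^ 2 * u)) : ℂ) * φ x :=
    φ.integrable.bdd_mul (c := 1) (by fun_prop) (.of_forall hb)
  have h3 : (∫ x : V, (Real.exp (-(π * ‖x‖ ^ 2 * u)) : ℂ) * φ x) -
      (∫ x : V, (Real.exp (-(π * ‖x‖ ^ 2 * u)) : ℂ) * subZeroOnBall φ x) =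
      (((1 - (1 + π * u) * Real.exp (-(π * u))) / u ^ 2 : ℝ) : ℂ) * φ 0 := by
    rw [← integral_sub h2 h1, ← integral_ball_gaussian hV hu, ← integral_complex_ofReal,
      ← integral_mul_const]
    congr 1
    funext x
    by_cases hx : ‖x‖ ≤ 1 <;> simp [subZeroOnBall, indicator, hx]
    ring
  rw [sub_eq_iff_eq_add] at h3
  rw [h3]
  simp only [Complex.ofReal_mul (u : ℝ), mul_assoc]
  rw [integral_const_mul]
  push_cast
  field_simp
  ring

end FourDimensional

section QuaternionFourier

open Set FourierTransform Module

theorem qLeb_eq_volume : qLeb = volume := by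
  have h1 := (Quaternion.linearIsometryEquivTuple.symm).measurePreserving
  have h2 := PiLp.volume_preserving_toLp (Fin 4)
  exact (h1.comp h2).map_eq

theorem integral_muH_s19 {E : Type*} [NormedAddCommGroup E] [NormedSpace ℝ E] (f : ℍ[ℝ] → E) :
    ∫ x, f x ∂muH = (4 : ℝ) • ∫ x, f x := by
  rw [muH, qLeb_eq_volume, integral_smul_measure]
  simp

theorem setIntegral_muH {E : Type*} [NormedAddCommGroup E] [NormedSpace ℝ E] (s : Set ℍ[ℝ])
    (f : ℍ[ℝ] → E) : ∫ x in s, f x ∂muH = (4 : ℝ) • ∫ x in s, f x := by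
  rw [muH, qLeb_eq_volume, Measure.restrict_smul, integral_smul_measure]
  simp

/-- Quaternionic conjugation as a linear isometry. -/
def starIsometry : ℍ[ℝ] ≃ₗᵢ[ℝ] ℍ[ℝ] where
  toFun := star
  invFun := star
  map_add' := star_add
  map_smul' := fun r x => Quaternion.star_smul r x
  left_inv := star_star
  right_inv := star_star
  norm_map' := Quaternion.norm_star

theorem starIsometry_apply (y : ℍ[ℝ]) : starIsometry y = star y := rfl

theorem Fq_eq_fourier (φ : SchwartzMap ℍ[ℝ] ℂ) (y : ℍ[ℝ]) :
    Fq φ y = 4 * 𝓕 φ (starIsometry ((-2 : ℝ) • y)) := by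
  rw [Fq, integral_muH_s19, SchwartzMap.fourier_coe, Real.fourier_eq', Complex.real_smul]
  push_cast
  congr 2
  funext x
  rw [starIsometry_apply, Quaternion.inner_def, star_star, mul_smul_comm, Quaternion.re_smul,
    smul_eq_mul, smul_eq_mul, mul_comm]
  push_cast
  ring_nf

theorem finrank_quaternion_real : finrank ℝ ℍ[ℝ] = 4 := Quaternion.finrank_eq_four

theorem normSq_sq_eq_norm_pow (x : ℍ[ℝ]) : normSq x ^ 2 = ‖x‖ ^ 4 := by
  rw [Quaternion.normSq_eq_norm_mul_self]
  ring

theorem integral_neg_log_mul_Fq (φ : SchwartzMap ℍ[ℝ] ℂ) :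
    ∫ y : ℍ[ℝ], ((-Real.log (normSq y ^ 2) : ℝ) : ℂ) * Fq (⇑φ) y ∂muH =
      2 * ∫ w : ℍ[ℝ], ((Real.log 4 - 2 * Real.log ‖w‖ : ℝ) : ℂ) * 𝓕 φ w := by
  have hne : ∀ᵐ w : ℍ[ℝ], w ≠ 0 := by
    simp [ae_iff, measure_singleton]
  let g : ℍ[ℝ] → ℂ := fun w => ((Real.log 4 - 2 * Real.log ‖w‖ : ℝ) : ℂ) * 𝓕 φ w
  have h1 : ∫ y : ℍ[ℝ], ((-Real.log (normSq y ^ 2) : ℝ) : ℂ) * Fq (⇑φ) y =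
      ∫ y : ℍ[ℝ], 8 * g (starIsometry ((-2 : ℝ) • y)) := by
    refine integral_congr_ae ?_
    filter_upwards [hne] with y hy
    have hy : ‖y‖ ≠ 0 := norm_ne_zero_iff.2 hy
    have hlog : Real.log 4 = 2 * Real.log 2 := by
      rw [show (4 : ℝ) = 2 ^ 2 by norm_num, Real.log_pow]
      norm_num
    simp only [g, Fq_eq_fourier, normSq_sq_eq_norm_pow, LinearIsometryEquiv.norm_map, norm_smul]
    rw [Real.log_pow, norm_neg, Real.norm_ofNat, Real.log_mul two_ne_zero hy, hlog]
    push_cast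
    ring
  rw [integral_muH_s19, h1, integral_const_mul,
    Measure.integral_comp_smul volume (fun y => g (starIsometry y)) (-2),
    starIsometry.measurePreserving.integral_comp
      starIsometry.toHomeomorph.measurableEmbedding g, finrank_quaternion_real]
  change _ = 2 * ∫ w, g w
  generalize ∫ w, g w = I
  simp only [Complex.real_smul]
  norm_num
  ring

theorem integral_subZeroOnBall_div (φ : SchwartzMap ℍ[ℝ] ℂ) :
    (∫ x in {x : ℍ[ℝ] | normSq x ^ 2 ≤ 1},
          (φ x - φ 0) / ((2 * (π : ℂ) ^ 2) * ((normSq x ^ 2 : ℝ) : ℂ)) ∂muH) +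
      (∫ x in {x : ℍ[ℝ] | 1 < normSq x ^ 2},
          φ x / ((2 * (π : ℂ) ^ 2) * ((normSq x ^ 2 : ℝ) : ℂ)) ∂muH) =
      2 * (((π ^ 2)⁻¹ : ℝ) * ∫ x : ℍ[ℝ], subZeroOnBall φ x / ((‖x‖ ^ 4 : ℝ) : ℂ)) := by
  have hS : MeasurableSet {x : ℍ[ℝ] | normSq x ^ 2 ≤ 1} :=
    (isClosed_le (Quaternion.continuous_normSq.pow 2) continuous_const).measurableSet
  have hc : {x : ℍ[ℝ] | 1 < normSq x ^ 2} = {x : ℍ[ℝ] | normSq x ^ 2 ≤ 1}ᶜ := by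
    ext x
    simp
  have hmem : ∀ x : ℍ[ℝ], normSq x ^ 2 ≤ 1 ↔ ‖x‖ ≤ 1 := fun x => by
    rw [normSq_sq_eq_norm_pow]
    exact pow_le_one_iff_of_nonneg (norm_nonneg x) (by norm_num)
  rw [hc, setIntegral_muH, setIntegral_muH, ← smul_add,
    ← integral_add_compl hS (integrable_subZeroOnBall_div finrank_quaternion_real φ),
    Complex.real_smul, mul_add, mul_add, mul_add]
  congr 1
  · rw [← integral_const_mul, ← integral_const_mul, ← integral_const_mul]
    refine setIntegral_congr_fun hS fun x hx => ?_
    have hx : ‖x‖ ≤ 1 := (hmem x).1 hx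
    simp only [subZeroOnBall, indicator, mem_Iic, hx, if_true, normSq_sq_eq_norm_pow]
    push_cast
    ring
  · rw [← integral_const_mul, ← integral_const_mul, ← integral_const_mul]
    refine setIntegral_congr_fun hS.compl fun x hx => ?_
    have hx : ¬ ‖x‖ ≤ 1 := fun h => hx ((hmem x).2 h)
    simp only [subZeroOnBall, indicator, mem_Iic, hx, if_false, normSq_sq_eq_norm_pow]
    push_cast
    ring

end QuaternionFourier

/-- **The Fourier transform of `-log|y|` on the quaternions** (Lemma 4.11).
As tempered distributions (`|y| = n(y)²`, self-dual measure `dx = 4dx₀dx₁dx₂dx₃`),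
`F(-log|y|)` is the distribution
`G(φ) = ∫_{|x|≤1}(φ(x)-φ(0)) dx/(2π²|x|) + ∫_{|x|>1} φ(x) dx/(2π²|x|)
  + (4 log(2π) + 4γ_e - 2) φ(0)`,
i.e. `∫ (-log|y|)(Fφ)(y) dy = G(φ)` for every Schwartz function `φ`. -/
theorem stmt19 (φ : SchwartzMap ℍ[ℝ] ℂ) :
    ∫ y : ℍ[ℝ], ((-Real.log (normSq y ^ 2) : ℝ) : ℂ) * Fq (⇑φ) y ∂muH =
      (∫ x in {x : ℍ[ℝ] | normSq x ^ 2 ≤ 1},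
          (φ x - φ 0) / ((2 * (π : ℂ) ^ 2) * ((normSq x ^ 2 : ℝ) : ℂ)) ∂muH) +
      (∫ x in {x : ℍ[ℝ] | 1 < normSq x ^ 2},
          φ x / ((2 * (π : ℂ) ^ 2) * ((normSq x ^ 2 : ℝ) : ℂ)) ∂muH) +
      ((4 * Real.log (2 * π) + 4 * Real.eulerMascheroniConstant - 2 : ℝ) : ℂ) * φ 0 := by
  rw [integral_neg_log_mul_Fq, integral_log_mul_fourier finrank_quaternion_real,
    integral_subZeroOnBall_div]
  push_cast
  ring
end
end
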